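/- arXiv:1301.3678 — 11 statements merged into one kernel-verified Lean document; each statement's English description precedes it below -/
import Mathlib

section
/- Let (X,ρ,μ) be a space of homogeneous type with quasi-triangle constant A0, let δ ∈ (0,1), and for each k ∈ ℤ let Z_k = {z^k_α : α ∈ I_k} be a maximal δ^k-separated subset of X. Then there exists a partial order ⪯ on the set of index pairs {(k,α) : k ∈ ℤ, α ∈ I_k} satisfying: (a) (k,α) ⪯ (l,β) implies k ≥ l; (b) for each (k,α) and each l ≤ k there exists a unique β ∈ I_l with (k,α) ⪯ (l,β); (c) (k,α) ⪯ (k−1,β) implies ρ(z^k_α, z^{k−1}_β) < δ^{k−1}; (d) ρ(z^k_α, z^{k−1}_β) < δ^{k−1}/(2A0) implies (k,α) ⪯ (k−1,β). -/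
open MeasureTheory Set

/-- A space of homogeneous type: `ρ` is a quasi-metric with quasi-triangle constant `A0`
whose balls are open, and `μ` is a doubling (Borel) measure with doubling constant `A1`. -/
structure IsHomogeneous {X : Type*} [TopologicalSpace X] [MeasurableSpace X] [BorelSpace X]
    (rho : X → X → ℝ) (mu : Measure X) (A0 A1 : ℝ) : Prop where
  nonempty : Nonempty X
  A0_ge_one : 1 ≤ A0
  A1_ge_one : 1 ≤ A1
  nonneg : ∀ x y, 0 ≤ rho x y
  eq_zero_iff : ∀ x y, rho x y = 0 ↔ x = y
  symm : ∀ x y, rho x y = rho y x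
  triangle : ∀ x y z, rho x z ≤ A0 * rho x y + A0 * rho y z
  ball_open : ∀ x r, 0 < r → IsOpen {y | rho x y < r}
  measure_ball_pos : ∀ x r, 0 < r → 0 < mu {y | rho x y < r}
  measure_ball_lt_top : ∀ x r, 0 < r → mu {y | rho x y < r} < ⊤
  doubling : ∀ x r, 0 < r →
    mu {y | rho x y < 2 * r} ≤ ENNReal.ofReal A1 * mu {y | rho x y < r}

/-- Lemma 6: existence of a partial order `⪯` on index pairs satisfying the
tree-structure properties (a)–(d). Here `le k a l b` means `(k,a) ⪯ (l,b)`. -/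
theorem exists_partial_order_on_pairs {X : Type*} [TopologicalSpace X]
    [MeasurableSpace X] [BorelSpace X] {I : ℤ → Type*} (rho : X → X → ℝ) (mu : Measure X)
    (A0 A1 delta : ℝ) (z : ∀ k, I k → X) (h : IsHomogeneous rho mu A0 A1)
    (hd0 : 0 < delta) (hd1 : delta < 1)
    (hsep : ∀ k (a b : I k), a ≠ b → delta ^ k ≤ rho (z k a) (z k b))
    (hmax : ∀ (k : ℤ) (x : X), ∃ a : I k, rho x (z k a) < delta ^ k) :
    ∃ le : ∀ k, I k → ∀ l, I l → Prop,
      (∀ k (a : I k), le k a k a) ∧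
      (∀ k (a : I k) l (b : I l) m (c : I m), le k a l b → le l b m c → le k a m c) ∧
      (∀ k (a b : I k), le k a k b → le k b k a → a = b) ∧
      (∀ k (a : I k) l (b : I l), le k a l b → l ≤ k) ∧
      (∀ (k : ℤ) (a : I k) (l : ℤ), l ≤ k → ∃! b : I l, le k a l b) ∧
      (∀ (k : ℤ) (a : I k) (b : I (k - 1)),
        le k a (k - 1) b → rho (z k a) (z (k - 1) b) < delta ^ (k - 1)) ∧
      (∀ (k : ℤ) (a : I k) (b : I (k - 1)),
        rho (z k a) (z (k - 1) b) < delta ^ (k - 1) / (2 * A0) → le k a (k - 1) b) := by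
  have key : ∀ k (a : I k), ∃ b : I (k - 1), rho (z k a) (z (k - 1) b) < delta ^ (k - 1) ∧
      ∀ c : I (k - 1), rho (z k a) (z (k - 1) c) < delta ^ (k - 1) / (2 * A0) → c = b := by
    intro k a
    have hA := h.A0_ge_one
    have hA' : 0 < 2 * A0 := by linarith
    have hp : 0 < delta ^ (k - 1) := zpow_pos hd0 _
    by_cases hc : ∃ b : I (k - 1), rho (z k a) (z (k - 1) b) < delta ^ (k - 1) / (2 * A0)
    · obtain ⟨b, hb⟩ := hc
      refine ⟨b, lt_of_lt_of_le hb (div_le_self hp.le (by linarith)), ?_⟩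
      intro c hc
      by_contra hne
      have h1 := hsep (k - 1) c b hne
      have h2 := h.triangle (z (k - 1) c) (z k a) (z (k - 1) b)
      rw [h.symm (z (k - 1) c) (z k a)] at h2
      rw [lt_div_iff₀ hA'] at hb hc
      nlinarith
    · obtain ⟨b, hb⟩ := hmax (k - 1) (z k a)
      exact ⟨b, hb, fun c hc' => (hc ⟨c, hc'⟩).elim⟩
  choose p hp1 hp2 using key
  let P : (Σ k, I k) → (Σ k, I k) := fun x => ⟨x.1 - 1, p x.1 x.2⟩
  have hfst : ∀ (n : ℕ) (x : Σ k, I k), (P^[n] x).1 = x.1 - n := by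
    intro n
    induction n with
    | zero => intro x; simp
    | succ n ih =>
      intro x
      rw [Function.iterate_succ_apply, ih]
      simp only [P]
      push_cast
      ring
  have hn : ∀ (n : ℕ) k (a : I k) l (b : I l), P^[n] ⟨k, a⟩ = ⟨l, b⟩ → l = k - n := by
    intro n k a l b e
    have := hfst n ⟨k, a⟩
    rw [e] at this
    exact this
  refine ⟨fun k a l b => ∃ n : ℕ, P^[n] ⟨k, a⟩ = ⟨l, b⟩, ?_, ?_, ?_, ?_, ?_, ?_, ?_⟩
  · exact fun k a => ⟨0, rfl⟩
  · rintro k a l b m c ⟨n, e⟩ ⟨n', e'⟩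
    exact ⟨n' + n, by rw [Function.iterate_add_apply, e, e']⟩
  · rintro k a b ⟨n, e⟩ -
    have := hn n _ _ _ _ e
    obtain rfl : n = 0 := by omega
    simpa using e
  · rintro k a l b ⟨n, e⟩
    have := hn n _ _ _ _ e
    omega
  · intro k a l hl
    have h1 := hfst (k - l).toNat ⟨k, a⟩
    obtain ⟨⟨l', b⟩, hb⟩ : ∃ y, P^[(k - l).toNat] ⟨k, a⟩ = y := ⟨_, rfl⟩
    rw [hb] at h1
    obtain rfl : l' = l := by simp only at h1; omega
    refine ⟨b, ⟨_, hb⟩, ?_⟩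
    rintro c ⟨n, e⟩
    have := hn n _ _ _ _ e
    obtain rfl : n = (k - l').toNat := by omega
    rw [hb] at e
    simpa using e.symm
  · rintro k a b ⟨n, e⟩
    have := hn n _ _ _ _ e
    obtain rfl : n = 1 := by omega
    have e' : p k a = b := by simpa [P] using e
    exact e' ▸ hp1 k a
  · intro k a b hb
    exact ⟨1, by simp [P, hp2 k a b hb]⟩
end

section
/- Under the standing assumptions, if additionally δ < 1/(2A0), then (l,β) ⪯ (k,α) implies ρ(z^l_β, z^k_α) ≤ 2 A0 δ^k. -/
open MeasureTheory Set

/-- The standing assumptions: a space of homogeneous type together with, for each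
generation `k : ℤ`, a maximal `δ^k`-separated family of centers `z k : ι k → X`, and a
partial order `le` on index pairs (`le k a l b` means `(k,a) ⪯ (l,b)`) satisfying
the tree-structure properties (a)–(d) of Christ's construction. -/
structure DyadicSystem {X : Type*} [TopologicalSpace X] [MeasurableSpace X] [BorelSpace X]
    (rho : X → X → ℝ) (mu : Measure X) (A0 A1 delta : ℝ) {I : ℤ → Type*}
    (z : ∀ k, I k → X) (le : ∀ k, I k → ∀ l, I l → Prop) : Prop where
  homog : IsHomogeneous rho mu A0 A1
  delta_pos : 0 < delta
  delta_lt_one : delta < 1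
  separated : ∀ k (a b : I k), a ≠ b → delta ^ k ≤ rho (z k a) (z k b)
  maximal : ∀ (k : ℤ) (x : X), ∃ a : I k, rho x (z k a) < delta ^ k
  le_refl : ∀ k (a : I k), le k a k a
  le_trans : ∀ k (a : I k) l (b : I l) m (c : I m), le k a l b → le l b m c → le k a m c
  le_antisymm : ∀ k (a b : I k), le k a k b → le k b k a → a = b
  le_gen : ∀ k (a : I k) l (b : I l), le k a l b → l ≤ k
  exists_unique_ancestor : ∀ (k : ℤ) (a : I k) (l : ℤ), l ≤ k → ∃! b : I l, le k a l b
  le_close : ∀ (k : ℤ) (a : I k) (b : I (k - 1)),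
    le k a (k - 1) b → rho (z k a) (z (k - 1) b) < delta ^ (k - 1)
  le_parent : ∀ (k : ℤ) (a : I k) (b : I (k - 1)),
    rho (z k a) (z (k - 1) b) < delta ^ (k - 1) / (2 * A0) → le k a (k - 1) b

/-- The dyadic cube `Q^k_α := ⋃_{(l,β) ⪯ (k,α)} B(z^l_β, a0 δ^l)`. -/
def dyadicCube {X : Type*} (rho : X → X → ℝ) (delta a0 : ℝ) {I : ℤ → Type*}
    (z : ∀ k, I k → X) (le : ∀ k, I k → ∀ l, I l → Prop) (k : ℤ) (a : I k) : Set X :=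
  ⋃ (l : ℤ) (b : I l) (_ : le l b k a), {y | rho (z l b) y < a0 * delta ^ l}

/-- Lemma 8: if `(l,β) ⪯ (k,α)` then `ρ(z^l_β, z^k_α) ≤ 2 A0 δ^k`, provided `δ < 1/(2A0)`. -/
theorem dist_center_ancestor_le {X : Type*} [TopologicalSpace X]
    [MeasurableSpace X] [BorelSpace X] {I : ℤ → Type*} (rho : X → X → ℝ) (mu : Measure X)
    (A0 A1 delta : ℝ) (z : ∀ k, I k → X) (le : ∀ k, I k → ∀ l, I l → Prop)
    (hsys : DyadicSystem rho mu A0 A1 delta z le)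
    (hdelta : delta < 1 / (2 * A0))
    (k l : ℤ) (a : I k) (b : I l) (hle : le l b k a) :
    rho (z l b) (z k a) ≤ 2 * A0 * delta ^ k := by
  have hk : k ≤ l := hsys.le_gen _ _ _ _ hle
  have hd := hsys.delta_pos
  have hA := hsys.homog.A0_ge_one
  have hdA : 2 * A0 * delta ≤ 1 := by
    rw [lt_div_iff₀ (by linarith)] at hdelta
    linarith
  revert a
  induction k, hk using Int.le_induction_down with
  | base =>
    intro a hle
    have hab : b = a := (hsys.exists_unique_ancestor l b l le_rfl).unique (hsys.le_refl l b) hle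
    subst hab
    rw [(hsys.homog.eq_zero_iff _ _).2 rfl]
    positivity
  | pred m hm ih =>
    intro a hle
    obtain ⟨c, hc, -⟩ := hsys.exists_unique_ancestor l b m hm
    obtain ⟨a', ha', -⟩ := hsys.exists_unique_ancestor m c (m - 1) (by omega)
    have haa : a' = a := (hsys.exists_unique_ancestor l b (m - 1) (by omega)).unique
      (hsys.le_trans _ _ _ _ _ _ hc ha') hle
    subst haa
    have h1 := ih c hc
    have h2 := hsys.le_close m c a' ha'
    have h3 := hsys.homog.triangle (z l b) (z m c) (z (m - 1) a')
    have h4 : delta ^ m = delta ^ (m - 1) * delta := by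
      rw [← zpow_add_one₀ hd.ne', sub_add_cancel]
    have h5 : 0 < delta ^ (m - 1) := zpow_pos hd _
    have h6 : 2 * A0 * delta ^ m ≤ delta ^ (m - 1) := by
      rw [h4]
      nlinarith
    have h7 : rho (z l b) (z m c) ≤ delta ^ (m - 1) := h1.trans h6
    nlinarith
end

section
/- Under the standing assumptions, if additionally δ < 1/(2A0) and a0 ∈ (0,1), then every dyadic cube Q^k_α satisfies diam(Q^k_α) ≤ C1 δ^k with C1 = A0 + 3A0³ + 2A0⁴; in particular Q^k_α ⊂ B(z^k_α, C1 δ^k). -/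
open MeasureTheory Set

/-- A point of a ball `B(z^l_β, a0 δ^l)` with `(l,β) ⪯ (k,α)` is within `2 A0 δ^k` of `z^k_α`. -/
theorem dyadic_center_dist {X : Type*} [TopologicalSpace X]
    [MeasurableSpace X] [BorelSpace X] {I : ℤ → Type*} (rho : X → X → ℝ) (mu : Measure X)
    (A0 A1 delta a0 : ℝ) (z : ∀ k, I k → X) (le : ∀ k, I k → ∀ l, I l → Prop)
    (hsys : DyadicSystem rho mu A0 A1 delta z le)
    (hdelta : delta < 1 / (2 * A0)) (ha1 : a0 < 1) (x : X) (n : ℕ) :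
    ∀ (k : ℤ) (a : I k) (l : ℤ) (b : I l), l = k + n → le l b k a →
      rho (z l b) x < a0 * delta ^ l → rho (z k a) x < 2 * A0 * delta ^ k := by
  have hA := hsys.homog.A0_ge_one
  have hd := hsys.delta_pos
  have hAd : 2 * A0 * delta < 1 := by
    rw [lt_div_iff₀ (by positivity)] at hdelta
    linarith
  induction n with
  | zero =>
    intro k a l b hl hle hx
    have hl' : l = k := by simpa using hl
    subst hl'
    have hab : b = a :=
      (hsys.exists_unique_ancestor l b l (_root_.le_refl l)).unique (hsys.le_refl l b) hle
    subst hab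
    have hp : 0 < delta ^ l := zpow_pos hd l
    nlinarith
  | succ n ih =>
    intro k a l b hl hle hx
    obtain ⟨m, rfl⟩ : ∃ m, k = m - 1 := ⟨k + 1, by ring⟩
    push_cast at hl
    obtain ⟨c, hc, -⟩ := hsys.exists_unique_ancestor l b m (by omega)
    obtain ⟨d, hcd, -⟩ := hsys.exists_unique_ancestor m c (m - 1) (by omega)
    have hda : d = a :=
      (hsys.exists_unique_ancestor l b (m - 1) (by omega)).unique
        (hsys.le_trans _ _ _ _ _ _ hc hcd) hle
    subst hda
    have h1 := ih m c l b (by omega) hc hx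
    have h2 := hsys.le_close m c d hcd
    have h3 := hsys.homog.triangle (z (m - 1) d) (z m c) x
    rw [hsys.homog.symm (z (m - 1) d) (z m c)] at h3
    have hp : 0 < delta ^ (m - 1) := zpow_pos hd _
    have he : delta ^ m = delta ^ (m - 1) * delta := by
      rw [← zpow_add_one₀ hd.ne']
      congr 1
      ring
    rw [he] at h1
    have h4 : 2 * A0 * (delta ^ (m - 1) * delta) ≤ delta ^ (m - 1) := by nlinarith
    nlinarith

/-- Theorem 7(c): `diam(Q^k_α) ≤ C1 δ^k` with `C1 = A0 + 3 A0³ + 2 A0⁴`; in particular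
`Q^k_α ⊆ B(z^k_α, C1 δ^k)`. -/
theorem dyadicCube_diam_le {X : Type*} [TopologicalSpace X]
    [MeasurableSpace X] [BorelSpace X] {I : ℤ → Type*} (rho : X → X → ℝ) (mu : Measure X)
    (A0 A1 delta a0 : ℝ) (z : ∀ k, I k → X) (le : ∀ k, I k → ∀ l, I l → Prop)
    (hsys : DyadicSystem rho mu A0 A1 delta z le)
    (hdelta : delta < 1 / (2 * A0)) (ha0 : 0 < a0) (ha1 : a0 < 1)
    (k : ℤ) (a : I k) :
    (∀ x ∈ dyadicCube rho delta a0 z le k a, ∀ y ∈ dyadicCube rho delta a0 z le k a,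
      rho x y ≤ (A0 + 3 * A0 ^ 3 + 2 * A0 ^ 4) * delta ^ k) ∧
    dyadicCube rho delta a0 z le k a ⊆
      {y | rho (z k a) y < (A0 + 3 * A0 ^ 3 + 2 * A0 ^ 4) * delta ^ k} := by
  have hA := hsys.homog.A0_ge_one
  have hp : 0 < delta ^ k := zpow_pos hsys.delta_pos k
  have key : ∀ x ∈ dyadicCube rho delta a0 z le k a, rho (z k a) x < 2 * A0 * delta ^ k := by
    intro x hx
    simp only [dyadicCube, mem_iUnion, mem_ofPred_eq] at hx
    obtain ⟨l, b, hle, hx⟩ := hx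
    have hkl := hsys.le_gen _ _ _ _ hle
    exact dyadic_center_dist rho mu A0 A1 delta a0 z le hsys hdelta ha1 x (l - k).toNat
      k a l b (by omega) hle hx
  have h2 : A0 ≤ A0 ^ 2 := by nlinarith
  have h3 : A0 ^ 2 ≤ A0 ^ 3 := by nlinarith
  have h4 : A0 ^ 3 ≤ A0 ^ 4 := by nlinarith [pow_pos (by linarith : 0 < A0) 3]
  have hC : 4 * A0 ^ 2 ≤ A0 + 3 * A0 ^ 3 + 2 * A0 ^ 4 := by linarith
  have hC' := mul_le_mul_of_nonneg_right hC hp.le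
  refine ⟨fun x hx y hy => ?_, fun x hx => ?_⟩
  · have hx' := key x hx
    have hy' := key y hy
    have ht := hsys.homog.triangle x (z k a) y
    rw [hsys.homog.symm x (z k a)] at ht
    nlinarith
  · have hx' := key x hx
    have : 2 * A0 * delta ^ k ≤ 4 * A0 ^ 2 * delta ^ k :=
      mul_le_mul_of_nonneg_right (by linarith) hp.le
    exact lt_of_lt_of_le hx' (this.trans hC')
end

section
/- Under the standing assumptions, if additionally δ < 1/(8A0³) and a0 < 1/(8A0³), then dyadic cubes of the same generation are disjoint: if Q^k_α ∩ Q^k_β ≠ ∅ then α = β. -/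
open MeasureTheory Set

theorem chain_bound {X : Type*} [TopologicalSpace X]
    [MeasurableSpace X] [BorelSpace X] {I : ℤ → Type*} (rho : X → X → ℝ) (mu : Measure X)
    (A0 A1 delta : ℝ) (z : ∀ k, I k → X) (le : ∀ k, I k → ∀ l, I l → Prop)
    (hsys : DyadicSystem rho mu A0 A1 delta z le)
    (hd : 8 * A0 ^ 3 * delta < 1) (j : ℕ) :
    ∀ (m n : ℤ), n = m + j → ∀ (t : I n) (c : I m), le n t m c →
      rho (z n t) (z m c) < 2 * A0 * delta ^ m := by
  have hA := hsys.homog.A0_ge_one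
  have hdp := hsys.delta_pos
  induction j with
  | zero =>
    intro m n h t c htc
    obtain rfl : n = m := by simpa using h
    have : t = c := (hsys.exists_unique_ancestor n t n le_rfl).unique (hsys.le_refl n t) htc
    subst this
    rw [(hsys.homog.eq_zero_iff _ _).2 rfl]
    have := zpow_pos hdp n
    positivity
  | succ j ih =>
    intro m n h t c htc
    obtain ⟨p, rfl⟩ : ∃ p, m = p - 1 := ⟨m + 1, by ring⟩
    have hpn : n = p + j := by push_cast at h; linarith
    obtain ⟨g, hg, -⟩ := hsys.exists_unique_ancestor n t p (by omega)
    obtain ⟨e, he, -⟩ := hsys.exists_unique_ancestor p g (p - 1) (by omega)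
    have hec : e = c := (hsys.exists_unique_ancestor n t (p - 1) (by omega)).unique
      (hsys.le_trans _ _ _ _ _ _ hg he) htc
    subst hec
    have h1 := ih p n hpn t g hg
    have h2 := hsys.le_close p g e he
    have h3 := hsys.homog.triangle (z n t) (z p g) (z (p - 1) e)
    have hD := zpow_pos hdp (p - 1)
    have hp : delta ^ p = delta ^ (p - 1) * delta := by
      rw [← zpow_add_one₀ hdp.ne']; congr 1; ring
    rw [hp] at h1
    set D := delta ^ (p - 1)
    have h4 : 2 * A0 * delta < 1 := by
      have : A0 ≤ A0 ^ 3 := le_self_pow₀ hA (by norm_num)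
      nlinarith [mul_le_mul_of_nonneg_right this hdp.le, mul_pos (by linarith : 0 < A0) hdp]
    have h5 : rho (z n t) (z p g) < D := by nlinarith
    nlinarith

theorem disjoint_aux {X : Type*} [TopologicalSpace X]
    [MeasurableSpace X] [BorelSpace X] {I : ℤ → Type*} (rho : X → X → ℝ) (mu : Measure X)
    (A0 A1 delta a0 : ℝ) (z : ∀ k, I k → X) (le : ∀ k, I k → ∀ l, I l → Prop)
    (hsys : DyadicSystem rho mu A0 A1 delta z le)
    (ha0 : 0 < a0) (hd : 8 * A0 ^ 3 * delta < 1) (ha : 8 * A0 ^ 3 * a0 < 1)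
    (k : ℤ) (a b : I k) (l n : ℤ) (s : I l) (t : I n) (x : X) (hln : l ≤ n)
    (hs : le l s k a) (ht : le n t k b) (hxs : rho (z l s) x < a0 * delta ^ l)
    (hxt : rho (z n t) x < a0 * delta ^ n) : a = b := by
  have hA := hsys.homog.A0_ge_one
  have hA' : 0 < A0 := by linarith
  have hdp := hsys.delta_pos
  suffices h : le n t l s from
    (hsys.exists_unique_ancestor n t k (hsys.le_gen _ _ _ _ ht)).unique
      (hsys.le_trans _ _ _ _ _ _ h hs) ht
  have hD := zpow_pos hdp l
  have hDn : delta ^ n ≤ delta ^ l :=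
    zpow_le_zpow_right_of_le_one₀ hdp hsys.delta_lt_one.le hln
  have h1 := hsys.homog.triangle (z n t) x (z l s)
  rw [hsys.homog.symm x] at h1
  have h2 : rho (z n t) (z l s) < 2 * A0 * a0 * delta ^ l := by
    have : a0 * delta ^ n ≤ a0 * delta ^ l := by gcongr
    nlinarith
  rcases hln.eq_or_lt with rfl | hlt
  · by_cases hts : t = s
    · subst hts; exact hsys.le_refl _ _
    · exfalso
      have h3 := hsys.separated _ _ _ hts
      have : A0 ≤ A0 ^ 3 := le_self_pow₀ hA (by norm_num)
      have h4 : 2 * A0 * a0 < 1 := by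
        nlinarith [mul_le_mul_of_nonneg_right this ha0.le, mul_pos hA' ha0]
      nlinarith
  · obtain ⟨p, rfl⟩ : ∃ p, l = p - 1 := ⟨l + 1, by ring⟩
    obtain ⟨g, hg, -⟩ := hsys.exists_unique_ancestor n t p (by omega)
    refine hsys.le_trans _ _ _ _ _ _ hg (hsys.le_parent p g s ?_)
    have h3 := chain_bound rho mu A0 A1 delta z le hsys hd (n - p).toNat p n (by omega) t g hg
    have h4 := hsys.homog.triangle (z p g) (z n t) (z (p - 1) s)
    rw [hsys.homog.symm (z p g) (z n t)] at h4
    have hp : delta ^ p = delta ^ (p - 1) * delta := by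
      rw [← zpow_add_one₀ hdp.ne']; congr 1; ring
    rw [hp] at h3
    set D := delta ^ (p - 1)
    rw [lt_div_iff₀ (by positivity)]
    have h5 : rho (z p g) (z (p - 1) s) < 2 * A0 ^ 2 * (delta + a0) * D := by nlinarith
    calc rho (z p g) (z (p - 1) s) * (2 * A0)
        < 2 * A0 ^ 2 * (delta + a0) * D * (2 * A0) := by gcongr
      _ = (8 * A0 ^ 3 * delta + 8 * A0 ^ 3 * a0) / 2 * D := by ring
      _ < D := by nlinarith

/-- Lemma 9: dyadic cubes of the same generation are pairwise disjoint. -/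
theorem dyadicCube_same_gen_disjoint {X : Type*} [TopologicalSpace X]
    [MeasurableSpace X] [BorelSpace X] {I : ℤ → Type*} (rho : X → X → ℝ) (mu : Measure X)
    (A0 A1 delta a0 : ℝ) (z : ∀ k, I k → X) (le : ∀ k, I k → ∀ l, I l → Prop)
    (hsys : DyadicSystem rho mu A0 A1 delta z le)
    (ha0 : 0 < a0) (ha1 : a0 < 1)
    (hdelta : delta < 1 / (8 * A0 ^ 3)) (ha : a0 < 1 / (8 * A0 ^ 3))
    (k : ℤ) (a b : I k)
    (hne : (dyadicCube rho delta a0 z le k a ∩ dyadicCube rho delta a0 z le k b).Nonempty) :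
    a = b := by
  have hA := hsys.homog.A0_ge_one
  have h8 : 0 < 8 * A0 ^ 3 := by positivity
  rw [lt_div_iff₀ h8, mul_comm] at hdelta ha
  obtain ⟨x, hxa, hxb⟩ := hne
  simp only [dyadicCube, mem_iUnion, mem_setOf_eq] at hxa hxb
  obtain ⟨l, s, hs, hxs⟩ := hxa
  obtain ⟨n, t, ht, hxt⟩ := hxb
  rcases le_total l n with h | h
  · exact disjoint_aux rho mu A0 A1 delta a0 z le hsys ha0 hdelta ha k a b l n s t x h hs ht hxs hxt
  · exact (disjoint_aux rho mu A0 A1 delta a0 z le hsys ha0 hdelta ha k b a n l t s x h ht hs hxt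
      hxs).symm
end

section
/- Under the standing assumptions, if additionally δ < 1/(8A0³) and a0 < 1/(8A0³), then for all l ≥ k, α ∈ I_k and β ∈ I_l, either Q^l_β ⊂ Q^k_α or Q^l_β ∩ Q^k_α = ∅. -/
open MeasureTheory Set

theorem rho_anc_lt {X : Type*} [TopologicalSpace X]
    [MeasurableSpace X] [BorelSpace X] {I : ℤ → Type*} {rho : X → X → ℝ} {mu : Measure X}
    {A0 A1 delta : ℝ} {z : ∀ k, I k → X} {le : ∀ k, I k → ∀ l, I l → Prop}
    (hsys : DyadicSystem rho mu A0 A1 delta z le)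
    (hd : 2 * A0 * delta ≤ 1) (n : ℕ) :
    ∀ (q : ℤ) (e : I q) (m : ℤ) (c : I m), m = q + n → le m c q e →
      rho (z q e) (z m c) < 2 * A0 * delta ^ q := by
  have hA := hsys.homog.A0_ge_one
  have hdp := hsys.delta_pos
  induction n with
  | zero =>
    intro q e m c hm hle
    have hm' : m = q := by simpa using hm
    subst hm'
    have hce : c = e :=
      (hsys.exists_unique_ancestor m c m le_rfl).unique (hsys.le_refl m c) hle
    subst hce
    rw [(hsys.homog.eq_zero_iff _ _).2 rfl]
    positivity
  | succ n ih =>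
    intro q e m c hm hle
    obtain ⟨p, rfl⟩ : ∃ p, q = p - 1 := ⟨q + 1, by ring⟩
    have hmp : m = p + n := by push_cast at hm; linarith
    obtain ⟨f, hf, -⟩ := hsys.exists_unique_ancestor m c p (by omega)
    obtain ⟨e', he', -⟩ := hsys.exists_unique_ancestor p f (p - 1) (by omega)
    have hee : e' = e := (hsys.exists_unique_ancestor m c (p - 1) (by omega)).unique
      (hsys.le_trans _ _ _ _ _ _ hf he') hle
    subst hee
    have h1 := hsys.le_close p f e' he'
    have h2 := ih p f m c hmp hf
    have h3 := hsys.homog.triangle (z (p-1) e') (z p f) (z m c)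
    rw [hsys.homog.symm (z (p-1) e') (z p f)] at h3
    have hpow : delta ^ p = delta * delta ^ (p - 1) := by
      rw [← zpow_one_add₀ hdp.ne']; congr 1; ring
    have hP : 0 < delta ^ (p - 1) := zpow_pos hdp _
    rw [hpow] at h2
    have h4 : 2 * A0 * (delta * delta ^ (p-1)) ≤ delta ^ (p-1) := by nlinarith
    nlinarith

theorem le_of_balls_meet {X : Type*} [TopologicalSpace X]
    [MeasurableSpace X] [BorelSpace X] {I : ℤ → Type*} {rho : X → X → ℝ} {mu : Measure X}
    {A0 A1 delta a0 : ℝ} {z : ∀ k, I k → X} {le : ∀ k, I k → ∀ l, I l → Prop}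
    (hsys : DyadicSystem rho mu A0 A1 delta z le)
    (ha0 : 0 < a0)
    (hdelta : delta < 1 / (8 * A0 ^ 3)) (ha : a0 < 1 / (8 * A0 ^ 3))
    (n m : ℤ) (hnm : n ≤ m) (d : I n) (c : I m) (x : X)
    (hxd : rho (z n d) x < a0 * delta ^ n) (hxc : rho (z m c) x < a0 * delta ^ m) :
    le m c n d := by
  have hA := hsys.homog.A0_ge_one
  have hdp := hsys.delta_pos
  have hA0 : 0 < A0 := by linarith
  have hA2 : 1 ≤ A0 ^ 2 := one_le_pow₀ hA
  rw [lt_div_iff₀ (by positivity)] at hdelta ha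
  have h3 := hsys.homog.triangle (z m c) x (z n d)
  rw [hsys.homog.symm x] at h3
  rcases hnm.eq_or_lt with h | h
  · subst h
    by_cases hcd : c = d
    · subst hcd; exact hsys.le_refl _ _
    · exfalso
      have hs := hsys.separated n c d hcd
      have hP : 0 < delta ^ n := zpow_pos hdp _
      have : 2 * A0 * a0 ≤ 1 := by
        have : A0 * a0 * 1 ≤ A0 * a0 * A0 ^ 2 := by gcongr
        nlinarith [mul_pos hA0 ha0]
      have h5 : A0 * rho (z n c) x < A0 * (a0 * delta ^ n) := by gcongr
      have h6 : A0 * rho (z n d) x < A0 * (a0 * delta ^ n) := by gcongr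
      have h7 : 2 * A0 * a0 * delta ^ n ≤ 1 * delta ^ n := by gcongr
      linarith
  · obtain ⟨p, rfl⟩ : ∃ p, n = p - 1 := ⟨n + 1, by ring⟩
    obtain ⟨e, he, -⟩ := hsys.exists_unique_ancestor m c p (by omega)
    refine hsys.le_trans _ _ _ _ _ _ he (hsys.le_parent _ _ _ ?_)
    have hd2 : 2 * A0 * delta ≤ 1 := by
      have : A0 * delta * 1 ≤ A0 * delta * A0 ^ 2 := by gcongr
      nlinarith [mul_pos hA0 hdp]
    have h1 := rho_anc_lt hsys hd2 (m - p).toNat p e m c (by omega) he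
    have h2 := hsys.homog.triangle (z p e) (z m c) (z (p-1) d)
    have hpow : delta ^ p = delta * delta ^ (p - 1) := by
      rw [← zpow_one_add₀ hdp.ne']; congr 1; ring
    have hP : 0 < delta ^ (p - 1) := zpow_pos hdp _
    have hmP : delta ^ m ≤ delta ^ (p - 1) :=
      zpow_le_zpow_right_of_le_one₀ hdp hsys.delta_lt_one.le hnm
    rw [hpow] at h1
    generalize delta ^ (p - 1) = P at *
    rw [lt_div_iff₀ (by positivity)]
    have hxc' : rho (z m c) x < a0 * P := hxc.trans_le (by gcongr)
    have h4 : rho (z m c) (z (p-1) d) < 2 * A0 * (a0 * P) := by nlinarith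
    have h5 : rho (z p e) (z (p-1) d) < A0 * (2 * A0 * (delta * P)) + A0 * (2 * A0 * (a0 * P)) := by
      nlinarith
    have h6 : rho (z p e) (z (p-1) d) * (2 * A0) <
      (A0 * (2 * A0 * (delta * P)) + A0 * (2 * A0 * (a0 * P))) * (2 * A0) := by gcongr
    have h7 : delta * (8 * A0 ^ 3) * P < 1 * P := by gcongr
    have h8 : a0 * (8 * A0 ^ 3) * P < 1 * P := by gcongr
    nlinarith

/-- Theorem 7(e): for `l ≥ k`, either `Q^l_β ⊆ Q^k_α` or `Q^l_β ∩ Q^k_α = ∅`. -/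
theorem dyadicCube_subset_or_disjoint {X : Type*} [TopologicalSpace X]
    [MeasurableSpace X] [BorelSpace X] {I : ℤ → Type*} (rho : X → X → ℝ) (mu : Measure X)
    (A0 A1 delta a0 : ℝ) (z : ∀ k, I k → X) (le : ∀ k, I k → ∀ l, I l → Prop)
    (hsys : DyadicSystem rho mu A0 A1 delta z le)
    (ha0 : 0 < a0) (ha1 : a0 < 1)
    (hdelta : delta < 1 / (8 * A0 ^ 3)) (ha : a0 < 1 / (8 * A0 ^ 3))
    (k l : ℤ) (hkl : k ≤ l) (a : I k) (b : I l) :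
    dyadicCube rho delta a0 z le l b ⊆ dyadicCube rho delta a0 z le k a ∨
      dyadicCube rho delta a0 z le l b ∩ dyadicCube rho delta a0 z le k a = ∅ := by
  rw [or_iff_not_imp_right]
  intro hne
  obtain ⟨x, hx1, hx2⟩ := Set.nonempty_iff_ne_empty.2 hne
  simp only [dyadicCube, Set.mem_iUnion, Set.mem_setOf_eq] at hx1 hx2
  obtain ⟨m, c, hcb, hxc⟩ := hx1
  obtain ⟨n, d, hda, hxd⟩ := hx2
  have hba : le l b k a := by
    obtain ⟨a', ha', -⟩ := hsys.exists_unique_ancestor l b k hkl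
    have hca' := hsys.le_trans _ _ _ _ _ _ hcb ha'
    have key : a' = a := by
      rcases le_total n m with h | h
      · have hcd := le_of_balls_meet hsys ha0 hdelta ha n m h d c x hxd hxc
        exact (hsys.exists_unique_ancestor m c k (hsys.le_gen _ _ _ _ hca')).unique hca'
          (hsys.le_trans _ _ _ _ _ _ hcd hda)
      · have hdc := le_of_balls_meet hsys ha0 hdelta ha m n h c d x hxc hxd
        exact (hsys.exists_unique_ancestor n d k (hsys.le_gen _ _ _ _ hda)).unique
          (hsys.le_trans _ _ _ _ _ _ hdc hca') hda
    exact key ▸ ha'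
  intro y hy
  simp only [dyadicCube, Set.mem_iUnion, Set.mem_setOf_eq] at hy ⊢
  obtain ⟨j, f, hf, hy⟩ := hy
  exact ⟨j, f, hsys.le_trans _ _ _ _ _ _ hf hba, hy⟩
end

section
/- Under the standing assumptions, if additionally δ < 1/(8A0³) and a0 < 1/(8A0³), then for every dyadic cube Q^k_α and every l < k there exists a unique β ∈ I_l such that Q^k_α ⊂ Q^l_β. -/
open MeasureTheory Set

section Helpers

variable {X : Type*} [TopologicalSpace X] [MeasurableSpace X] [BorelSpace X]
  {rho : X → X → ℝ} {mu : Measure X} {A0 A1 delta : ℝ} {I : ℤ → Type*}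
  {z : ∀ k, I k → X} {le : ∀ k, I k → ∀ l, I l → Prop}

/-- Two indices below which a common index lies are comparable. -/
theorem DyadicSystem.le_of_common (h : DyadicSystem rho mu A0 A1 delta z le)
    {n k l : ℤ} {c : I n} {f : I k} {e : I l} (hlk : l ≤ k)
    (hf : le n c k f) (he : le n c l e) : le k f l e := by
  obtain ⟨g, hg, -⟩ := h.exists_unique_ancestor k f l hlk
  have h1 := h.le_trans _ _ _ _ _ _ hf hg
  have h2 := (h.exists_unique_ancestor n c l (h.le_gen _ _ _ _ he)).unique h1 he
  exact h2 ▸ hg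

theorem DyadicSystem.chain (h : DyadicSystem rho mu A0 A1 delta z le)
    (hdelta : delta * (8 * A0 ^ 3) < 1) (m : ℕ) :
    ∀ (n k : ℤ) (_ : n = k + m) (c : I n) (e : I k), le n c k e →
      rho (z n c) (z k e) ≤ 2 * A0 * delta ^ k := by
  have hA := h.homog.A0_ge_one
  have hd := h.delta_pos
  induction m with
  | zero =>
    intro n k hn c e hce
    obtain rfl : n = k := by simpa using hn
    have : e = c := (h.exists_unique_ancestor n c n le_rfl).unique hce (h.le_refl n c)
    subst this
    rw [(h.homog.eq_zero_iff _ _).2 rfl]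
    positivity
  | succ m ih =>
    intro n k hn c e hce
    push_cast at hn
    obtain ⟨p, rfl⟩ : ∃ p, k = p - 1 := ⟨k + 1, by ring⟩
    obtain ⟨f, hf, -⟩ := h.exists_unique_ancestor n c p (by omega)
    have hfe := h.le_of_common (by omega) hf hce
    have h1 := ih n p (by omega) c f hf
    have h2 := h.le_close p f e hfe
    have h3 := h.homog.triangle (z n c) (z p f) (z (p - 1) e)
    have hp : delta ^ p = delta ^ (p - 1) * delta := by
      rw [← zpow_add_one₀ hd.ne']; congr 1; ring
    have hD : 0 < delta ^ (p - 1) := zpow_pos hd _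
    rw [hp] at h1
    have hsm : 2 * A0 * delta ≤ 1 := by
      have : A0 ≤ A0 ^ 3 := le_self_pow₀ hA (by norm_num)
      nlinarith
    have h4 : 2 * A0 * (delta ^ (p - 1) * delta) ≤ delta ^ (p - 1) := by nlinarith
    nlinarith

theorem DyadicSystem.le_of_close (h : DyadicSystem rho mu A0 A1 delta z le) {a0 : ℝ}
    (hdelta : delta * (8 * A0 ^ 3) < 1) (ha0 : 0 < a0) (ha : a0 * (8 * A0 ^ 3) < 1)
    {n k : ℤ} (hkn : k < n) (c : I n) (a : I k)
    (hr : rho (z n c) (z k a) < a0 * delta ^ k) : le n c k a := by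
  have hA := h.homog.A0_ge_one
  have hd := h.delta_pos
  obtain ⟨p, rfl⟩ : ∃ p, k = p - 1 := ⟨k + 1, by ring⟩
  obtain ⟨f, hf, -⟩ := h.exists_unique_ancestor n c p (by omega)
  refine h.le_trans _ _ _ _ _ _ hf (h.le_parent p f a ?_)
  have h1 := h.chain hdelta (n - p).toNat n p (by omega) c f hf
  have h3 := h.homog.triangle (z p f) (z n c) (z (p - 1) a)
  rw [h.homog.symm (z p f) (z n c)] at h3
  have hp : delta ^ p = delta ^ (p - 1) * delta := by
    rw [← zpow_add_one₀ hd.ne']; congr 1; ring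
  have hD : 0 < delta ^ (p - 1) := zpow_pos hd _
  rw [hp] at h1
  generalize delta ^ (p - 1) = D at *
  have hA0 : 0 < A0 := by linarith
  rw [lt_div_iff₀ (by positivity)]
  have h4 : rho (z p f) (z (p - 1) a) ≤
      A0 * (2 * A0 * (D * delta)) + A0 * (a0 * D) := by
    refine h3.trans (add_le_add ?_ ?_) <;> gcongr
  have h5 : rho (z p f) (z (p - 1) a) * (2 * A0) ≤
      (A0 * (2 * A0 * (D * delta)) + A0 * (a0 * D)) * (2 * A0) := by gcongr
  have h6 : 4 * A0 ^ 3 * delta < 1 / 2 := by linarith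
  have h7 : 2 * A0 ^ 2 * a0 < 1 / 4 := by
    have : A0 ^ 2 ≤ A0 ^ 3 := pow_le_pow_right₀ hA (by norm_num)
    nlinarith
  have h8 : (4 * A0 ^ 3 * delta + 2 * A0 ^ 2 * a0) * D < 1 * D := by
    apply mul_lt_mul_of_pos_right _ hD; linarith
  linarith

end Helpers

/-- Theorem 7(d): each dyadic cube has a unique ancestor in every earlier generation. -/
theorem dyadicCube_exists_unique_ancestor {X : Type*} [TopologicalSpace X]
    [MeasurableSpace X] [BorelSpace X] {I : ℤ → Type*} (rho : X → X → ℝ) (mu : Measure X)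
    (A0 A1 delta a0 : ℝ) (z : ∀ k, I k → X) (le : ∀ k, I k → ∀ l, I l → Prop)
    (hsys : DyadicSystem rho mu A0 A1 delta z le)
    (ha0 : 0 < a0) (ha1 : a0 < 1)
    (hdelta : delta < 1 / (8 * A0 ^ 3)) (ha : a0 < 1 / (8 * A0 ^ 3))
    (k l : ℤ) (hlk : l < k) (a : I k) :
    ∃! b : I l, dyadicCube rho delta a0 z le k a ⊆ dyadicCube rho delta a0 z le l b := by
  have hA := hsys.homog.A0_ge_one
  have hd := hsys.delta_pos
  have hA3 : 0 < 8 * A0 ^ 3 := by positivity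
  rw [lt_div_iff₀ hA3] at hdelta ha
  obtain ⟨b, hb, -⟩ := hsys.exists_unique_ancestor k a l hlk.le
  refine ⟨b, ?_, ?_⟩
  · intro y hy
    simp only [dyadicCube, mem_iUnion] at hy ⊢
    obtain ⟨n, c, hc, hy⟩ := hy
    exact ⟨n, c, hsys.le_trans _ _ _ _ _ _ hc hb, hy⟩
  · intro b' hb'
    have hz : z k a ∈ dyadicCube rho delta a0 z le k a := by
      simp only [dyadicCube, mem_iUnion]
      refine ⟨k, a, hsys.le_refl k a, ?_⟩
      rw [mem_setOf_eq, (hsys.homog.eq_zero_iff _ _).2 rfl]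
      positivity
    have hz' := hb' hz
    simp only [dyadicCube, mem_iUnion] at hz'
    obtain ⟨n, c, hc, hr⟩ := hz'
    rw [mem_setOf_eq] at hr
    have hln := hsys.le_gen _ _ _ _ hc
    rcases lt_trichotomy n k with hnk | rfl | hkn
    · rw [hsys.homog.symm] at hr
      have h1 := hsys.le_of_close hdelta ha0 ha hnk a c hr
      exact (hsys.exists_unique_ancestor k a l hlk.le).unique
        (hsys.le_trans _ _ _ _ _ _ h1 hc) hb
    · have hca : c = a := by
        by_contra hne
        have h1 := hsys.separated n c a hne
        have hD : 0 < delta ^ n := zpow_pos hd _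
        nlinarith
      subst hca
      exact (hsys.exists_unique_ancestor n c l hln).unique hc hb
    · have hD : delta ^ n ≤ delta ^ k :=
        zpow_le_zpow_right_of_le_one₀ hd hsys.delta_lt_one.le hkn.le
      have h1 := hsys.le_of_close hdelta ha0 ha hkn c a
        (hr.trans_le (mul_le_mul_of_nonneg_left hD ha0.le))
      exact (hsys.exists_unique_ancestor n c l hln).unique hc
        (hsys.le_trans _ _ _ _ _ _ h1 hb)
end

section
/- Under the standing assumptions, if additionally δ and a0 are smaller than 1/(8A0³), then for every k ∈ ℤ the cubes of generation k cover X up to a null set: μ(X \ ⋃_{α ∈ I_k} Q^k_α) = 0. -/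
open MeasureTheory Set

/-- Iterated doubling. -/
lemma doubling_iter {X : Type*} [TopologicalSpace X] [MeasurableSpace X] [BorelSpace X]
    {rho : X → X → ℝ} {mu : Measure X} {A0 A1 : ℝ} (h : IsHomogeneous rho mu A0 A1)
    (n : ℕ) (x : X) (r : ℝ) (hr : 0 < r) :
    mu {y | rho x y < 2 ^ n * r} ≤ ENNReal.ofReal A1 ^ n * mu {y | rho x y < r} := by
  induction n with
  | zero => simp
  | succ n ih =>
    have h1 := h.doubling x (2 ^ n * r) (by positivity)
    have e : (2 : ℝ) ^ (n + 1) * r = 2 * (2 ^ n * r) := by ring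
    rw [e]
    calc _ ≤ _ := h1
      _ ≤ ENNReal.ofReal A1 * (ENNReal.ofReal A1 ^ n * mu {y | rho x y < r}) := by gcongr
      _ = _ := by rw [pow_succ]; ring

theorem dyadicCube_cover_ae {X : Type*} [TopologicalSpace X]
    [MeasurableSpace X] [BorelSpace X] {I : ℤ → Type*} (rho : X → X → ℝ) (mu : Measure X)
    (A0 A1 delta a0 : ℝ) (z : ∀ k, I k → X) (le : ∀ k, I k → ∀ l, I l → Prop)
    (hsys : DyadicSystem rho mu A0 A1 delta z le)
    (ha0 : 0 < a0) (ha1 : a0 < 1)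
    (hdelta : delta < 1 / (8 * A0 ^ 3)) (ha : a0 < 1 / (8 * A0 ^ 3))
    (k : ℤ) :
    mu ((⋃ a : I k, dyadicCube rho delta a0 z le k a)ᶜ) = 0 := by
  have H := hsys.homog
  have hA := H.A0_ge_one
  have hA0 : 0 < A0 := by linarith
  have hd := hsys.delta_pos
  have hdp : ∀ l : ℤ, 0 < delta ^ l := fun l => zpow_pos hd l
  obtain ⟨x0⟩ := H.nonempty
  set E : Set X := (⋃ a : I k, dyadicCube rho delta a0 z le k a)ᶜ with hE
  -- every small ball of generation at least `k` misses `E`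
  have hmiss : ∀ (m : ℤ) (b : I m) (x : X), k ≤ m → rho (z m b) x < a0 * delta ^ m → x ∉ E := by
    intro m b x hm hx hxE
    obtain ⟨c, hc, -⟩ := hsys.exists_unique_ancestor m b k hm
    apply hxE
    simp only [dyadicCube, mem_iUnion, mem_setOf_eq]
    exact ⟨c, m, b, hc, hx⟩
  obtain ⟨s, hs⟩ : ∃ s, s = a0 / (4 * A0) := ⟨_, rfl⟩
  have hs0 : 0 < s := by rw [hs]; positivity
  have hsA : 4 * (A0 * s) = a0 := by rw [hs]; field_simp
  have hs1 : s < 1 := by nlinarith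
  obtain ⟨N, hN⟩ : ∃ N : ℕ, 1 / s < 2 ^ N := pow_unbounded_of_one_lt _ (by norm_num)
  have hN2 : 1 ≤ 2 ^ N * s := by
    rw [div_lt_iff₀ hs0] at hN; exact hN.le
  -- reduction to balls
  suffices hball : ∀ R : ℝ, 0 < R → mu (E ∩ {y | rho x0 y < R}) = 0 by
    have hcov : E ⊆ ⋃ n : ℕ, E ∩ {y | rho x0 y < (n : ℝ) + 1} := by
      intro x hx
      obtain ⟨n, hn⟩ := exists_nat_gt (rho x0 x)
      exact mem_iUnion.2 ⟨n, hx, by simp only [mem_setOf_eq]; linarith⟩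
    exact measure_mono_null hcov (measure_iUnion_null fun n => hball _ (by positivity))
  intro R hR
  let l : ℕ → ℤ := fun j => k + j
  let ε : ℕ → ℝ := fun j => 2 * A0 * delta ^ (l j)
  have hlj : ∀ j, delta ^ (l j) = delta ^ k * delta ^ j := by
    intro j
    simp only [l]
    rw [zpow_add₀ hd.ne', zpow_natCast]
  have hε0 : ∀ j, 0 < ε j := fun j => by have := hdp (l j); simp only [ε]; positivity
  have hεanti : Antitone ε := by
    intro i j hij
    simp only [ε, hlj]
    have := hdp k
    have h2 : delta ^ j ≤ delta ^ i := pow_le_pow_of_le_one hd.le hsys.delta_lt_one.le hij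
    gcongr
  have hεlim : Filter.Tendsto ε Filter.atTop (nhds 0) := by
    have h1 := tendsto_pow_atTop_nhds_zero_of_lt_one hd.le hsys.delta_lt_one
    have h2 := h1.const_mul (2 * A0 * delta ^ k)
    rw [mul_zero] at h2
    refine h2.congr fun j => ?_
    simp only [ε, hlj]; ring
  obtain ⟨RR, hRR⟩ : ∃ RR, RR = A0 * R + A0 * ε 0 := ⟨_, rfl⟩
  have hRRpos : 0 < RR := by have := hε0 0; rw [hRR]; positivity
  let O : Set X := ⋃ (m : ℤ) (_ : k ≤ m) (b : I m), {y | rho (z m b) y < s * delta ^ m}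
  let T : ℕ → Set X := fun j =>
    ((⋃ x ∈ E, {y | rho x y < ε j}) ∩ {y | rho x0 y < RR}) ∩ O
  have hTmeas : ∀ j, MeasurableSet (T j) := by
    intro j
    refine IsOpen.measurableSet (((isOpen_biUnion fun x _ => H.ball_open _ _ (hε0 j)).inter
      (H.ball_open _ _ hRRpos)).inter ?_)
    exact isOpen_iUnion fun m => isOpen_iUnion fun _ => isOpen_iUnion fun b =>
      H.ball_open _ _ (mul_pos hs0 (hdp m))
  have hTanti : Antitone T := by
    intro i j hij y hy
    obtain ⟨⟨h1, h2⟩, h3⟩ := hy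
    refine ⟨⟨?_, h2⟩, h3⟩
    simp only [mem_iUnion, mem_setOf_eq] at h1 ⊢
    obtain ⟨x, hx, hxy⟩ := h1
    exact ⟨x, hx, hxy.trans_le (hεanti hij)⟩
  have hTfin : ∀ j, mu (T j) < ⊤ := fun j =>
    (measure_mono (fun y hy => hy.1.2)).trans_lt (H.measure_ball_lt_top x0 RR hRRpos)
  have hTempty : ⋂ j, T j = ∅ := by
    rw [eq_empty_iff_forall_notMem]
    intro y hy
    rw [mem_iInter] at hy
    have hO := (hy 0).2
    simp only [O, mem_iUnion, mem_setOf_eq] at hO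
    obtain ⟨m, hm, b, hb⟩ := hO
    obtain ⟨j, hj⟩ := (hεlim.eventually (gt_mem_nhds (mul_pos hs0 (hdp m)))).exists
    have h1 := (hy j).1.1
    simp only [mem_iUnion, mem_setOf_eq] at h1
    obtain ⟨x, hx, hxy⟩ := h1
    refine hmiss m b x hm ?_ hx
    have ht := H.triangle (z m b) y x
    rw [H.symm y x] at ht
    have h2 : A0 * rho (z m b) y ≤ A0 * (s * delta ^ m) := by gcongr
    have h3 : A0 * rho x y ≤ A0 * (s * delta ^ m) := by
      have := hxy.trans hj
      gcongr
    have h4 : a0 * delta ^ m = 4 * (A0 * s * delta ^ m) := by rw [← hsA]; ring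
    have h5 : 0 < A0 * s * delta ^ m := by have := hdp m; positivity
    nlinarith
  have hlim : Filter.Tendsto (fun j => mu (T j)) Filter.atTop (nhds 0) := by
    have := tendsto_measure_iInter_atTop (μ := mu) (s := T)
      (fun j => (hTmeas j).nullMeasurableSet) hTanti ⟨0, (hTfin 0).ne⟩
    rw [hTempty, measure_empty] at this
    exact this
  obtain ⟨C, hC⟩ : ∃ C, C = ENNReal.ofReal A1 ^ N := ⟨_, rfl⟩
  have hCtop : C ≠ ⊤ := by rw [hC]; exact ENNReal.pow_ne_top ENNReal.ofReal_ne_top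
  have hmain : ∀ j, mu (E ∩ {y | rho x0 y < R}) ≤ C * mu (T j) := by
    intro j
    let J : Set (I (l j)) := {b | ∃ x ∈ E, rho x0 x < R ∧ rho x (z (l j) b) < delta ^ (l j)}
    let B : J → Set X := fun b => {y | rho (z (l j) b) y < s * delta ^ (l j)}
    have hdl := hdp (l j)
    have hsd : 0 < s * delta ^ (l j) := mul_pos hs0 hdl
    have hBmeas : ∀ b, MeasurableSet (B b) := fun b => (H.ball_open _ _ hsd).measurableSet
    have hBdisj : Pairwise (Function.onFun Disjoint B) := by
      intro b c hbc
      rw [Function.onFun, Set.disjoint_left]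
      intro y hyb hyc
      simp only [B, mem_setOf_eq] at hyb hyc
      have h1 := hsys.separated (l j) b c (fun h => hbc (Subtype.ext h))
      have ht := H.triangle (z (l j) b) y (z (l j) c)
      rw [H.symm y] at ht
      have h2 : A0 * rho (z (l j) b) y ≤ A0 * (s * delta ^ (l j)) := by gcongr
      have h3 : A0 * rho (z (l j) c) y ≤ A0 * (s * delta ^ (l j)) := by gcongr
      have h4 : 4 * (A0 * (s * delta ^ (l j))) = a0 * delta ^ (l j) := by rw [← hsA]; ring
      have h5 : a0 * delta ^ (l j) < 1 * delta ^ (l j) := by gcongr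
      linarith
    have hBT : (⋃ b, B b) ⊆ T j := by
      refine iUnion_subset ?_
      rintro ⟨b, x, hxE, hxR, hxb⟩ y hy
      simp only [B, mem_setOf_eq] at hy
      have hxy : rho x y < ε j := by
        have ht := H.triangle x (z (l j) b) y
        have h2 : A0 * rho x (z (l j) b) < A0 * delta ^ (l j) := by gcongr
        have h3 : A0 * rho (z (l j) b) y ≤ A0 * (s * delta ^ (l j)) := by gcongr
        have h4 : A0 * (s * delta ^ (l j)) ≤ A0 * (1 * delta ^ (l j)) := by gcongr
        simp only [ε]
        linarith
      refine ⟨⟨?_, ?_⟩, ?_⟩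
      · simp only [mem_iUnion, mem_setOf_eq]
        exact ⟨x, hxE, hxy⟩
      · simp only [mem_setOf_eq]
        have ht := H.triangle x0 x y
        have h2 : A0 * rho x0 x < A0 * R := by gcongr
        have h3 : A0 * rho x y ≤ A0 * ε 0 := by
          have := hxy.le.trans (hεanti (Nat.zero_le j))
          gcongr
        linarith
      · simp only [O, mem_iUnion, mem_setOf_eq]
        exact ⟨l j, by simp [l], b, hy⟩
    have hsum : ∑' b, mu (B b) ≤ mu (T j) :=
      (tsum_meas_le_meas_iUnion_of_disjoint mu hBmeas hBdisj).trans (measure_mono hBT)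
    have hcount : Countable J := by
      have h1 : (Function.support fun b => mu (B b)).Countable :=
        Summable.countable_support_ennreal (hsum.trans_lt (hTfin j)).ne
      have h2 : (Function.support fun b => mu (B b)) = univ := by
        ext b
        simpa using (H.measure_ball_pos (z (l j) b) _ hsd).ne'
      rw [h2] at h1
      exact countable_univ_iff.1 h1
    have hcov : E ∩ {y | rho x0 y < R} ⊆ ⋃ b : J, {y | rho (z (l j) b) y < delta ^ (l j)} := by
      rintro x ⟨hxE, hxR⟩
      obtain ⟨b, hb⟩ := hsys.maximal (l j) x
      refine mem_iUnion.2 ⟨⟨b, x, hxE, hxR, hb⟩, ?_⟩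
      simp only [mem_setOf_eq]
      rwa [H.symm]
    calc mu (E ∩ {y | rho x0 y < R})
        ≤ ∑' b : J, mu {y | rho (z (l j) b) y < delta ^ (l j)} :=
          (measure_mono hcov).trans (measure_iUnion_le _)
      _ ≤ ∑' b : J, C * mu (B b) := by
          refine ENNReal.tsum_le_tsum fun b => ?_
          rw [hC]
          refine le_trans (measure_mono fun y hy => ?_) (doubling_iter H N _ _ hsd)
          simp only [mem_setOf_eq] at hy ⊢
          nlinarith
      _ = C * ∑' b : J, mu (B b) := ENNReal.tsum_mul_left
      _ ≤ C * mu (T j) := by gcongr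
  have hlim2 := ENNReal.Tendsto.const_mul hlim (Or.inr hCtop)
  rw [mul_zero] at hlim2
  exact le_antisymm (ge_of_tendsto' hlim2 hmain) (zero_le)
end

section
/- Under the standing assumptions, if additionally δ and a0 are smaller than 1/(8A0³), a0 < 3/(4A0), and δ < 1/(4A0²C1) where C1 = A0 + 3A0³ + 2A0⁴, then with C3 = 1/(4A0²), every dyadic cube Q^k_α satisfies B(z^k_α, C3 δ^k) ∩ X̂ ⊂ Q^k_α, where X̂ := X \ ⋃_{k∈ℤ} (X \ ⋃_{α∈I_k} Q^k_α). -/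
open MeasureTheory Set

theorem center_dist_aux {X : Type*} [TopologicalSpace X]
    [MeasurableSpace X] [BorelSpace X] {I : ℤ → Type*} (rho : X → X → ℝ) (mu : Measure X)
    (A0 A1 delta : ℝ) (z : ∀ k, I k → X) (le : ∀ k, I k → ∀ l, I l → Prop)
    (hsys : DyadicSystem rho mu A0 A1 delta z le) (hd : 2 * A0 * delta ≤ 1) (n : ℕ) :
    ∀ (m l : ℤ) (b : I m) (c : I l), l = m + n → le l c m b →
      rho (z m b) (z l c) ≤ 2 * A0 * delta ^ m := by
  have hA := hsys.homog.A0_ge_one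
  have hclose : ∀ (k k' : ℤ) (a : I k) (b : I k'), k' = k - 1 →
      le k a k' b → rho (z k a) (z k' b) < delta ^ k' := by
    intro k k' a b h hle
    subst h
    exact hsys.le_close k a b hle
  induction n with
  | zero =>
    intro m l b c hl hle
    obtain rfl : l = m := by simpa using hl
    have hcb : c = b :=
      (hsys.exists_unique_ancestor l c l le_rfl).unique (hsys.le_refl l c) hle
    subst hcb
    rw [(hsys.homog.eq_zero_iff _ _).2 rfl]
    have := zpow_pos hsys.delta_pos l
    positivity
  | succ n ih =>
    intro m l b c hl hle
    push_cast at hl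
    obtain ⟨b', hb', -⟩ := hsys.exists_unique_ancestor l c (m + 1) (by omega)
    obtain ⟨b'', hb'', -⟩ := hsys.exists_unique_ancestor (m + 1) b' m (by omega)
    have hbb : b'' = b := (hsys.exists_unique_ancestor l c m (by omega)).unique
      (hsys.le_trans _ _ _ _ _ _ hb' hb'') hle
    subst hbb
    have h1 := hclose (m + 1) m b' b'' (by omega) hb''
    have h2 := ih (m + 1) l b' c (by omega) hb'
    have h3 := hsys.homog.triangle (z m b'') (z (m + 1) b') (z l c)
    rw [hsys.homog.symm (z m b'') (z (m + 1) b')] at h3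
    have hp := zpow_pos hsys.delta_pos m
    rw [zpow_add_one₀ hsys.delta_pos.ne'] at h2
    have h4 : 2 * A0 * (delta ^ m * delta) ≤ delta ^ m := by nlinarith
    have hA' : 0 ≤ A0 := by linarith
    have h5 := mul_le_mul_of_nonneg_left h1.le hA'
    have h6 := mul_le_mul_of_nonneg_left (h2.trans h4) hA'
    linarith

/-- Lemma 13: with `C3 = 1/(4A0²)`, every dyadic cube contains
`B(z^k_α, C3 δ^k) ∩ X̂`, where `X̂ = ⋂_j ⋃_β Q^j_β`. -/
theorem ball_inter_Xhat_subset_dyadicCube {X : Type*} [TopologicalSpace X]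
    [MeasurableSpace X] [BorelSpace X] {I : ℤ → Type*} (rho : X → X → ℝ) (mu : Measure X)
    (A0 A1 delta a0 : ℝ) (z : ∀ k, I k → X) (le : ∀ k, I k → ∀ l, I l → Prop)
    (hsys : DyadicSystem rho mu A0 A1 delta z le)
    (ha0 : 0 < a0) (ha1 : a0 < 1)
    (hdelta : delta < 1 / (8 * A0 ^ 3)) (ha : a0 < 1 / (8 * A0 ^ 3))
    (ha' : a0 < 3 / (4 * A0))
    (hdelta' : delta < 1 / (4 * A0 ^ 2 * (A0 + 3 * A0 ^ 3 + 2 * A0 ^ 4)))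
    (k : ℤ) (a : I k) :
    {y | rho (z k a) y < 1 / (4 * A0 ^ 2) * delta ^ k} ∩
        (⋂ j : ℤ, ⋃ b : I j, dyadicCube rho delta a0 z le j b) ⊆
      dyadicCube rho delta a0 z le k a := by
  have hA := hsys.homog.A0_ge_one
  have hA' : 0 ≤ A0 := by linarith
  have hAp : 0 < A0 := by linarith
  have hd0 := hsys.delta_pos
  have hA3 : A0 ≤ A0 ^ 3 := le_self_pow₀ hA (by norm_num)
  rw [lt_div_iff₀ (by positivity)] at hdelta hdelta'
  have hd : 2 * A0 * delta ≤ 1 := by nlinarith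
  rintro y ⟨hy, hyX⟩
  obtain ⟨b, hb⟩ := mem_iUnion.1 (mem_iInter.1 hyX (k + 1))
  simp only [dyadicCube, mem_iUnion, mem_setOf_eq] at hb hy ⊢
  obtain ⟨l, c, hcb, hyc⟩ := hb
  refine ⟨l, c, ?_, hyc⟩
  refine hsys.le_trans _ _ _ _ _ _ hcb ?_
  have hpar : ∀ (j j' : ℤ) (a : I j) (b : I j'), j' = j - 1 →
      rho (z j a) (z j' b) < delta ^ j' / (2 * A0) → le j a j' b := by
    intro j j' a b h hle
    subst h
    exact hsys.le_parent j a b hle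
  apply hpar (k + 1) k b a (by omega)
  have hl := hsys.le_gen _ _ _ _ hcb
  have h1 := center_dist_aux rho mu A0 A1 delta z le hsys hd (l - (k + 1)).toNat (k + 1) l b c
    (by omega) hcb
  have hp := zpow_pos hd0 k
  have hpl := zpow_pos hd0 l
  have hmono : delta ^ l ≤ delta ^ (k + 1) :=
    zpow_le_zpow_right_of_le_one₀ hd0 hsys.delta_lt_one.le hl
  have h2 : rho (z l c) y ≤ delta ^ (k + 1) := by nlinarith
  rw [zpow_add_one₀ hd0.ne'] at h1 h2
  have h3 := hsys.homog.triangle (z (k + 1) b) (z l c) y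
  have h4 := hsys.homog.triangle (z (k + 1) b) y (z k a)
  rw [hsys.homog.symm y] at h4
  have h5 := mul_le_mul_of_nonneg_left h1 hA'
  have h6 := mul_le_mul_of_nonneg_left h2 hA'
  have h7 : rho (z (k + 1) b) y ≤ (2 * A0 ^ 2 + A0) * (delta ^ k * delta) := by nlinarith
  have h8 := mul_le_mul_of_nonneg_left h7 hA'
  have h9 := mul_lt_mul_of_pos_left hy hAp
  have e1 : A0 * (1 / (4 * A0 ^ 2) * delta ^ k) = delta ^ k / (4 * A0) := by
    field_simp
  have e2 : delta ^ k / (2 * A0) = delta ^ k / (4 * A0) + delta ^ k / (4 * A0) := by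
    field_simp; norm_num
  have key : A0 * ((2 * A0 ^ 2 + A0) * (delta ^ k * delta)) ≤ delta ^ k / (4 * A0) := by
    rw [le_div_iff₀ (by positivity)]
    have q1 : A0 ^ 4 ≤ A0 ^ 5 := pow_le_pow_right₀ hA (by norm_num)
    have q2 : 0 < A0 ^ 6 := by positivity
    have q4 : 0 < A0 ^ 4 := by positivity
    have q3 : delta * (8 * A0 ^ 4 + 4 * A0 ^ 3) ≤ 1 := by
      refine le_trans ?_ hdelta'.le
      apply mul_le_mul_of_nonneg_left _ hd0.le
      nlinarith
    nlinarith [mul_le_mul_of_nonneg_left q3 hp.le]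
  rw [e1] at h9
  rw [e2]
  linarith
end

section
/- Under the standing assumptions, if δ and a0 are sufficiently small depending only on A0 and A1, then for each ε > 0 there exists τ > 0 (depending only on A0, A1, δ, a0 and ε) such that μ(E^k_α(τ)) < ε μ(Q^k_α) for every dyadic cube Q^k_α, where E^k_α(τ) := {x ∈ Q^k_α : ρ(x, X \ cl(Q^k_α)) < τ δ^k}. -/
open MeasureTheory Set

/-- `ρ(x, A) = inf_{y ∈ A} ρ(x,y)`, valued in `ℝ≥0∞` so that `ρ(x, ∅) = ∞`. -/
noncomputable def rhoDist {X : Type*} (rho : X → X → ℝ) (x : X) (A : Set X) : ENNReal :=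
  ⨅ y ∈ A, ENNReal.ofReal (rho x y)

/-- The `τ`-boundary `E^k_α(τ) = {x ∈ Q^k_α : ρ(x, X \ cl Q^k_α) < τ δ^k}` of a dyadic cube. -/
noncomputable def tauBoundary {X : Type*} [TopologicalSpace X] (rho : X → X → ℝ)
    (delta a0 : ℝ) {I : ℤ → Type*} (z : ∀ k, I k → X)
    (le : ∀ k, I k → ∀ l, I l → Prop) (k : ℤ) (a : I k) (tau : ℝ) : Set X :=
  {x ∈ dyadicCube rho delta a0 z le k a |
    rhoDist rho x ((closure (dyadicCube rho delta a0 z le k a))ᶜ)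
      < ENNReal.ofReal (tau * delta ^ k)}

section helpers

set_option linter.unusedSectionVars false

variable {X : Type} [TopologicalSpace X] [MeasurableSpace X] [BorelSpace X]
  {rho : X → X → ℝ} {mu : Measure X} {A0 A1 delta : ℝ} {I : ℤ → Type}
  {z : ∀ k, I k → X} {le : ∀ k, I k → ∀ l, I l → Prop}

theorem ds_close (h : DyadicSystem rho mu A0 A1 delta z le) (k l : ℤ) (hl : l = k - 1)
    (a : I k) (b : I l) (hab : le k a l b) : rho (z k a) (z l b) < delta ^ l := by
  subst hl
  exact h.le_close k a b hab

theorem ds_parent (h : DyadicSystem rho mu A0 A1 delta z le) (k l : ℤ) (hl : l = k - 1)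
    (a : I k) (b : I l) (hab : rho (z k a) (z l b) < delta ^ l / (2 * A0)) : le k a l b := by
  subst hl
  exact h.le_parent k a b hab

/-- intermediate ancestors -/
theorem ds_mid (h : DyadicSystem rho mu A0 A1 delta z le) (m : ℤ) (a : I m) (k : ℤ) (b : I k)
    (hab : le m a k b) (l : ℤ) (h1 : k ≤ l) (h2 : l ≤ m) :
    ∃ c : I l, le m a l c ∧ le l c k b := by
  obtain ⟨c, hc, -⟩ := h.exists_unique_ancestor m a l h2
  obtain ⟨d, hd, -⟩ := h.exists_unique_ancestor l c k h1
  have : d = b := (h.exists_unique_ancestor m a k (h1.trans h2)).unique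
    (h.le_trans _ _ _ _ _ _ hc hd) hab
  exact ⟨c, hc, this ▸ hd⟩

theorem ds_anc_dist (h : DyadicSystem rho mu A0 A1 delta z le) (hd : 12 * A0 ^ 3 * delta < 1)
    (n : ℕ) : ∀ (m : ℤ) (a : I m) (l : ℤ) (b : I l), m = l + n → le m a l b →
    rho (z m a) (z l b) ≤ 2 * A0 * delta ^ l := by
  have hA := h.homog.A0_ge_one
  have hdp := h.delta_pos
  induction n with
  | zero =>
    intro m a l b hm hab
    have hm : m = l := by simpa using hm
    subst hm
    have : a = b := (h.exists_unique_ancestor m a m le_rfl).unique (h.le_refl _ _) hab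
    subst this
    rw [(h.homog.eq_zero_iff _ _).2 rfl]
    have := zpow_pos hdp m
    positivity
  | succ n ih =>
    intro m a l b hm hab
    push_cast at hm
    obtain ⟨c, hc, hcb⟩ := ds_mid h m a l b hab (l + 1) (by lia) (by lia)
    have h1 := ih m a (l + 1) c (by lia) hc
    have h2 := ds_close h (l + 1) l (by ring) c b hcb
    have h3 := h.homog.triangle (z m a) (z (l + 1) c) (z l b)
    rw [zpow_add_one₀ hdp.ne'] at h1
    have hD := zpow_pos hdp l
    have hsm : 2 * A0 * delta ≤ 1 := by
      have : A0 ≤ A0 ^ 3 := by nlinarith [mul_nonneg (by linarith : 0 ≤ A0) (by nlinarith : 0 ≤ A0 ^ 2 - 1)]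
      nlinarith
    have h4 : A0 * rho (z m a) (z (l + 1) c) ≤ A0 * (delta ^ l) := by
      apply mul_le_mul_of_nonneg_left _ (by linarith)
      calc _ ≤ _ := h1
        _ = (2 * A0 * delta) * delta ^ l := by ring
        _ ≤ 1 * delta ^ l := by gcongr
        _ = _ := one_mul _
    have h5 : A0 * rho (z (l + 1) c) (z l b) ≤ A0 * (delta ^ l) :=
      mul_le_mul_of_nonneg_left h2.le (by linarith)
    linarith

theorem ds_anc (h : DyadicSystem rho mu A0 A1 delta z le) (hd : 12 * A0 ^ 3 * delta < 1)
    (m : ℤ) (a : I m) (l : ℤ) (b : I l) (hab : le m a l b) :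
    rho (z m a) (z l b) ≤ 2 * A0 * delta ^ l := by
  have := h.le_gen _ _ _ _ hab
  exact ds_anc_dist h hd (m - l).toNat m a l b (by lia) hab

theorem mem_cube {a0 : ℝ} {k : ℤ} {a : I k} {x : X} :
    x ∈ dyadicCube rho delta a0 z le k a ↔
      ∃ l b, le l b k a ∧ rho (z l b) x < a0 * delta ^ l := by
  simp [dyadicCube]

theorem ds_near (h : DyadicSystem rho mu A0 A1 delta z le) (hd : 12 * A0 ^ 3 * delta < 1)
    {a0 : ℝ} (ha0 : 0 < a0) (ha : 4 * A0 ^ 3 * a0 < 1)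
    (k : ℤ) (a : I k) (x : X) (hx : x ∈ dyadicCube rho delta a0 z le k a) (m : ℤ) (hm : k ≤ m) :
    ∃ c : I m, le m c k a ∧ rho (z m c) x ≤ 3 * A0 ^ 2 * delta ^ m := by
  have hA := h.homog.A0_ge_one
  have hdp := h.delta_pos
  have hA2 : A0 ≤ A0 ^ 2 := by nlinarith
  have hA3 : A0 ^ 2 ≤ A0 ^ 3 := by nlinarith [sq_nonneg A0]
  have ha1 : a0 ≤ 1 := by nlinarith
  obtain ⟨l, b, hba, hbx⟩ := mem_cube.1 hx
  have hkl := h.le_gen _ _ _ _ hba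
  rcases le_or_gt m l with hml | hml
  · obtain ⟨c, hc, hca⟩ := ds_mid h l b k a hba m hm hml
    refine ⟨c, hca, ?_⟩
    have h1 := ds_anc h hd l b m c hc
    have h2 := h.homog.triangle (z m c) (z l b) x
    rw [h.homog.symm (z m c) (z l b)] at h2
    have h3 : delta ^ l ≤ delta ^ m := zpow_le_zpow_right_of_le_one₀ hdp h.delta_lt_one.le hml
    have hD := zpow_pos hdp m
    have h4 : rho (z l b) x ≤ delta ^ m := by
      refine hbx.le.trans (le_trans ?_ h3)
      have := zpow_pos hdp l
      nlinarith
    have h5 : A0 * rho (z l b) (z m c) ≤ A0 * (2 * A0 * delta ^ m) :=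
      mul_le_mul_of_nonneg_left h1 (by linarith)
    have h6 : A0 * rho (z l b) x ≤ A0 ^ 2 * delta ^ m :=
      mul_le_mul hA2 h4 (h.homog.nonneg _ _) (by positivity)
    nlinarith
  · obtain ⟨g, hg⟩ := h.maximal m x
    obtain ⟨c, hc, -⟩ := h.exists_unique_ancestor m g (l + 1) (by lia)
    have h1 := ds_anc h hd m g (l + 1) c hc
    have h2 := h.homog.triangle (z (l + 1) c) (z m g) (z l b)
    have h3 := h.homog.triangle (z m g) x (z l b)
    rw [h.homog.symm (z (l + 1) c) (z m g)] at h2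
    rw [h.homog.symm x (z m g)] at hg
    rw [h.homog.symm x (z l b)] at h3
    have h4 : delta ^ m ≤ delta ^ (l + 1) :=
      zpow_le_zpow_right_of_le_one₀ hdp h.delta_lt_one.le (by lia)
    have hD := zpow_pos hdp l
    have hDm := zpow_pos hdp m
    rw [zpow_add_one₀ hdp.ne'] at h4 h1
    have key : rho (z (l + 1) c) (z l b) < delta ^ l / (2 * A0) := by
      rw [lt_div_iff₀ (by linarith)]
      have e1 : A0 * rho (z m g) (z (l + 1) c) ≤ A0 * (2 * A0 * (delta ^ l * delta)) :=
        mul_le_mul_of_nonneg_left h1 (by linarith)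
      have e2 : A0 * rho (z m g) x ≤ A0 * (delta ^ l * delta) :=
        mul_le_mul_of_nonneg_left (hg.le.trans h4) (by linarith)
      have e3 : A0 * rho (z l b) x ≤ A0 * (a0 * delta ^ l) :=
        mul_le_mul_of_nonneg_left hbx.le (by linarith)
      have e4 : A0 * rho (z m g) (z l b) ≤ A0 * (A0 * (delta ^ l * delta) + A0 * (a0 * delta ^ l)) :=
        mul_le_mul_of_nonneg_left (by linarith) (by linarith)
      have e5 : rho (z (l + 1) c) (z l b) ≤ A0 ^ 2 * (3 * delta + a0) * delta ^ l := by
        nlinarith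
      calc _ ≤ A0 ^ 2 * (3 * delta + a0) * delta ^ l * (2 * A0) :=
            mul_le_mul_of_nonneg_right e5 (by linarith)
        _ = (12 * A0 ^ 3 * delta + 4 * A0 ^ 3 * a0) / 2 * delta ^ l := by ring
        _ < 1 * delta ^ l := by gcongr; linarith
        _ = _ := one_mul _
    refine ⟨g, h.le_trans _ _ _ _ _ _ hc (h.le_trans _ _ _ _ _ _
      (ds_parent h (l + 1) l (by ring) c b key) hba), ?_⟩
    nlinarith

theorem ds_doubling (h : IsHomogeneous rho mu A0 A1) (x : X) (p : ℕ) : ∀ r : ℝ, 0 < r →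
    mu {y | rho x y < 2 ^ p * r} ≤ ENNReal.ofReal A1 ^ p * mu {y | rho x y < r} := by
  induction p with
  | zero => intro r hr; simp
  | succ p ih =>
    intro r hr
    calc mu {y | rho x y < 2 ^ (p + 1) * r} = mu {y | rho x y < 2 ^ p * (2 * r)} := by
          congr 1; ext y; simp only [mem_ofPred_eq]; rw [pow_succ, mul_assoc]
      _ ≤ ENNReal.ofReal A1 ^ p * mu {y | rho x y < 2 * r} := ih _ (by linarith)
      _ ≤ ENNReal.ofReal A1 ^ p * (ENNReal.ofReal A1 * mu {y | rho x y < r}) := by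
          gcongr; exact h.doubling x r hr
      _ = _ := by rw [pow_succ, mul_assoc]

theorem cube_open (h : DyadicSystem rho mu A0 A1 delta z le) {a0 : ℝ} (ha0 : 0 < a0)
    (k : ℤ) (a : I k) : IsOpen (dyadicCube rho delta a0 z le k a) := by
  unfold dyadicCube
  refine isOpen_iUnion fun l => isOpen_iUnion fun b => isOpen_iUnion fun _ => ?_
  exact h.homog.ball_open _ _ (mul_pos ha0 (zpow_pos h.delta_pos _))

theorem cube_pos (h : DyadicSystem rho mu A0 A1 delta z le) {a0 : ℝ} (ha0 : 0 < a0)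
    (k : ℤ) (a : I k) : 0 < mu (dyadicCube rho delta a0 z le k a) := by
  refine (h.homog.measure_ball_pos (z k a) (a0 * delta ^ k)
    (mul_pos ha0 (zpow_pos h.delta_pos _))).trans_le (measure_mono ?_)
  intro y hy
  exact mem_cube.2 ⟨k, a, h.le_refl _ _, hy⟩

theorem cube_lt_top (h : DyadicSystem rho mu A0 A1 delta z le) (hd : 12 * A0 ^ 3 * delta < 1)
    {a0 : ℝ} (ha0 : 0 < a0) (ha : 4 * A0 ^ 3 * a0 < 1)
    (k : ℤ) (a : I k) : mu (dyadicCube rho delta a0 z le k a) < ⊤ := by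
  have hA := h.homog.A0_ge_one
  have hD := zpow_pos h.delta_pos k
  refine (measure_mono ?_).trans_lt (h.homog.measure_ball_lt_top (z k a) (4 * A0 ^ 2 * delta ^ k)
    (by positivity))
  intro y hy
  obtain ⟨c, hc, hy⟩ := ds_near h hd ha0 ha k a y hy k le_rfl
  have : c = a := (h.exists_unique_ancestor k c k le_rfl).unique (h.le_refl _ _) hc
  subst this
  have : 0 < A0 ^ 2 * delta ^ k := by positivity
  simp only [mem_ofPred_eq]
  linarith

theorem boundary_spec {a0 tau : ℝ} {k : ℤ} {a : I k} {x : X}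
    (hx : x ∈ tauBoundary rho delta a0 z le k a tau) :
    x ∈ dyadicCube rho delta a0 z le k a ∧
      ∃ y, y ∉ dyadicCube rho delta a0 z le k a ∧ rho x y < tau * delta ^ k := by
  refine ⟨hx.1, ?_⟩
  have h2 := hx.2
  unfold rhoDist at h2
  simp only [iInf_lt_iff] at h2
  obtain ⟨y, hy, hlt⟩ := h2
  exact ⟨y, fun hyQ => hy (subset_closure hyQ), lt_of_not_ge fun hge =>
    absurd hlt (not_lt.2 (ENNReal.ofReal_le_ofReal hge))⟩

/-- layer of small balls at level `m` near the set `E` -/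
def layer (rho : X → X → ℝ) (delta : ℝ) (z : ∀ k, I k → X) (le : ∀ k, I k → ∀ l, I l → Prop)
    (k : ℤ) (a : I k) (E : Set X) (C eta : ℝ) (m : ℤ) : Set X :=
  ⋃ c : {c : I m // le m c k a ∧ ∃ x ∈ E, rho (z m c) x ≤ C * delta ^ m},
    {y | rho (z m c) y < eta * delta ^ m}

theorem layer_subset {k : ℤ} {a : I k} {E : Set X} {C eta a0 : ℝ} {m : ℤ}
    (hdp : 0 < delta) (he : eta ≤ a0) :
    layer rho delta z le k a E C eta m ⊆ dyadicCube rho delta a0 z le k a := by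
  intro y hy
  obtain ⟨⟨c, hc, _⟩, hy1⟩ := mem_iUnion.1 hy
  refine mem_cube.2 ⟨m, c, hc, lt_of_lt_of_le hy1 ?_⟩
  have := zpow_pos hdp m
  gcongr

theorem layer_open (h : DyadicSystem rho mu A0 A1 delta z le)
    {k : ℤ} {a : I k} {E : Set X} {C eta : ℝ} {m : ℤ} (he : 0 < eta) :
    IsOpen (layer rho delta z le k a E C eta m) :=
  isOpen_iUnion fun _ => h.homog.ball_open _ _ (mul_pos he (zpow_pos h.delta_pos _))

theorem layer_measure (h : DyadicSystem rho mu A0 A1 delta z le) (hd : 12 * A0 ^ 3 * delta < 1)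
    {a0 : ℝ} (ha0 : 0 < a0) (ha : 4 * A0 ^ 3 * a0 < 1)
    (k : ℤ) (a : I k) (E : Set X) (hE : E ⊆ dyadicCube rho delta a0 z le k a) (m : ℤ) (hm : k ≤ m)
    (eta : ℝ) (he : 0 < eta) (hea : eta ≤ a0) (hes : 2 * A0 * eta ≤ 1)
    (p : ℕ) (hp : 4 * A0 ^ 2 ≤ 2 ^ p * eta) :
    mu E ≤ ENNReal.ofReal A1 ^ p * mu (layer rho delta z le k a E (3 * A0 ^ 2) eta m) := by
  have hA := h.homog.A0_ge_one
  have hD := zpow_pos h.delta_pos m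
  set S := {c : I m // le m c k a ∧ ∃ x ∈ E, rho (z m c) x ≤ 3 * A0 ^ 2 * delta ^ m} with hS
  set B : S → Set X := fun c => {y | rho (z m c) y < eta * delta ^ m} with hB
  have hL : layer rho delta z le k a E (3 * A0 ^ 2) eta m = ⋃ c, B c := rfl
  have hmeas : ∀ c, MeasurableSet (B c) := fun c =>
    (h.homog.ball_open _ _ (mul_pos he hD)).measurableSet
  have hdisj : Pairwise (Function.onFun Disjoint B) := by
    intro c c' hcc
    refine Set.disjoint_left.2 fun y hy hy' => ?_
    have h1 := h.separated m c.1 c'.1 (fun e => hcc (Subtype.ext e))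
    have h2 := h.homog.triangle (z m c) y (z m c')
    rw [h.homog.symm y] at h2
    have h3 : rho (z m c) y < eta * delta ^ m := hy
    have h4 : rho (z m c') y < eta * delta ^ m := hy'
    have : A0 * rho (z m c) y + A0 * rho (z m c') y < 2 * A0 * eta * delta ^ m := by nlinarith
    nlinarith
  have hfin : mu (⋃ c, B c) ≠ ⊤ := by
    rw [← hL]
    exact ((measure_mono (layer_subset h.delta_pos hea)).trans_lt
      (cube_lt_top h hd ha0 ha k a)).ne
  have hcount := Measure.countable_meas_pos_of_disjoint_of_meas_iUnion_ne_top mu hmeas hdisj hfin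
  have huniv : {c : S | 0 < mu (B c)} = univ := by
    ext c
    simp only [mem_ofPred_eq, mem_univ, iff_true]
    exact h.homog.measure_ball_pos _ _ (mul_pos he hD)
  rw [huniv] at hcount
  have : Countable S := Set.countable_univ_iff.1 hcount
  have hcov : E ⊆ ⋃ c : S, {y | rho (z m c) y < 2 ^ p * (eta * delta ^ m)} := by
    intro x hx
    obtain ⟨c, hc, hcx⟩ := ds_near h hd ha0 ha k a x (hE hx) m hm
    refine mem_iUnion.2 ⟨⟨c, hc, x, hx, hcx⟩, ?_⟩
    have h1 : 4 * A0 ^ 2 * delta ^ m ≤ 2 ^ p * eta * delta ^ m := by gcongr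
    have : 0 < A0 ^ 2 * delta ^ m := by positivity
    simp only [mem_ofPred_eq]
    linarith
  calc mu E ≤ mu (⋃ c : S, {y | rho (z m c) y < 2 ^ p * (eta * delta ^ m)}) := measure_mono hcov
    _ ≤ ∑' c : S, mu {y | rho (z m c) y < 2 ^ p * (eta * delta ^ m)} := measure_iUnion_le _
    _ ≤ ∑' c : S, ENNReal.ofReal A1 ^ p * mu (B c) :=
        ENNReal.tsum_le_tsum fun c => ds_doubling h.homog _ p _ (mul_pos he hD)
    _ = ENNReal.ofReal A1 ^ p * ∑' c : S, mu (B c) := ENNReal.tsum_mul_left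
    _ = _ := by rw [hL, measure_iUnion hdisj hmeas]

theorem layer_disjoint (h : DyadicSystem rho mu A0 A1 delta z le)
    {a0 : ℝ} (ha0 : 0 < a0) (ha : a0 < 1)
    (k : ℤ) (a : I k) (E : Set X) (m m' : ℤ)
    (hE : ∀ x ∈ E, ∃ y, y ∉ dyadicCube rho delta a0 z le k a ∧ rho x y ≤ delta ^ m')
    (hmm : 20 * A0 ^ 5 * delta ^ m' ≤ a0 * delta ^ m) :
    Disjoint (layer rho delta z le k a E (3 * A0 ^ 2) (a0 / (4 * A0)) m)
      (layer rho delta z le k a E (3 * A0 ^ 2) (a0 / (4 * A0)) m') := by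
  have hA := h.homog.A0_ge_one
  have hD := zpow_pos h.delta_pos m
  have hD' := zpow_pos h.delta_pos m'
  have hA0p : 0 < A0 := by linarith
  refine Set.disjoint_left.2 fun w hw hw' => ?_
  obtain ⟨⟨c, hc, _⟩, hw1⟩ := mem_iUnion.1 hw
  obtain ⟨⟨c', _, x, hx, hcx⟩, hw2⟩ := mem_iUnion.1 hw'
  obtain ⟨y, hy, hxy⟩ := hE x hx
  refine hy (mem_cube.2 ⟨m, c, hc, ?_⟩)
  replace hw : rho (z m c) w < a0 / (4 * A0) * delta ^ m := hw1
  replace hw' : rho (z m' c') w < a0 / (4 * A0) * delta ^ m' := hw2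
  have t1 := h.homog.triangle (z m c) w y
  have t2 := h.homog.triangle w (z m' c') y
  have t3 := h.homog.triangle (z m' c') x y
  rw [h.homog.symm w (z m' c')] at t2
  have q2 : 1 ≤ A0 ^ 2 := one_le_pow₀ hA
  have e1 : A0 * rho (z m c) w ≤ a0 / 4 * delta ^ m := by
    calc _ ≤ A0 * (a0 / (4 * A0) * delta ^ m) := by gcongr
      _ = _ := by field_simp
  have e2 : A0 * rho (z m' c') w ≤ delta ^ m' := by
    calc _ ≤ A0 * (a0 / (4 * A0) * delta ^ m') := by gcongr
      _ = a0 / 4 * delta ^ m' := by field_simp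
      _ ≤ 1 * delta ^ m' := by gcongr; linarith
      _ = _ := one_mul _
  have e3 : rho (z m' c') y ≤ 4 * A0 ^ 3 * delta ^ m' := by
    calc _ ≤ _ := t3
      _ ≤ A0 * (3 * A0 ^ 2 * delta ^ m') + A0 * (A0 ^ 2 * delta ^ m') := by
          gcongr
          nlinarith
      _ = _ := by ring
  have e4 : rho w y ≤ 5 * A0 ^ 4 * delta ^ m' := by
    have q4 : 1 ≤ A0 ^ 4 := one_le_pow₀ hA
    calc _ ≤ _ := t2
      _ ≤ 1 * delta ^ m' + A0 * (4 * A0 ^ 3 * delta ^ m') := by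
          rw [one_mul]; gcongr
      _ ≤ A0 ^ 4 * delta ^ m' + A0 * (4 * A0 ^ 3 * delta ^ m') := by gcongr
      _ = _ := by ring
  have e5 : A0 * rho w y ≤ a0 / 4 * delta ^ m := by
    calc _ ≤ A0 * (5 * A0 ^ 4 * delta ^ m') := by gcongr
      _ = (20 * A0 ^ 5 * delta ^ m') / 4 := by ring
      _ ≤ (a0 * delta ^ m) / 4 := by gcongr
      _ = _ := by ring
  have : 0 < a0 * delta ^ m := by positivity
  linarith

theorem boundary_bound (h : DyadicSystem rho mu A0 A1 delta z le) (hd : 12 * A0 ^ 3 * delta < 1)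
    {a0 : ℝ} (ha0 : 0 < a0) (ha : 4 * A0 ^ 3 * a0 < 1) (s M p : ℕ)
    (hs : 20 * A0 ^ 5 * delta ^ s ≤ a0) (hp : 4 * A0 ^ 2 ≤ 2 ^ p * (a0 / (4 * A0)))
    (k : ℤ) (a : I k) :
    (M : ENNReal) * mu (tauBoundary rho delta a0 z le k a (delta ^ (s * M))) ≤
      ENNReal.ofReal A1 ^ p * mu (dyadicCube rho delta a0 z le k a) := by
  have hA := h.homog.A0_ge_one
  have hdp := h.delta_pos
  have hA0p : 0 < A0 := by linarith
  have q3 : 1 ≤ A0 ^ 3 := one_le_pow₀ hA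
  have ha1 : a0 < 1 := by nlinarith
  set E := tauBoundary rho delta a0 z le k a (delta ^ (s * M)) with hEdef
  have heta : 0 < a0 / (4 * A0) := by positivity
  have hea : a0 / (4 * A0) ≤ a0 := div_le_self ha0.le (by linarith)
  have hes : 2 * A0 * (a0 / (4 * A0)) ≤ 1 := by
    have : 2 * A0 * (a0 / (4 * A0)) = a0 / 2 := by field_simp; norm_num
    linarith
  set lev : ℕ → ℤ := fun j => k + ((s * j : ℕ) : ℤ) with hlev
  set G : ℕ → Set X := fun j =>
    layer rho delta z le k a E (3 * A0 ^ 2) (a0 / (4 * A0)) (lev j) with hG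
  have hlt : ∀ i j : ℕ, i < j → j < M → Disjoint (G i) (G j) := by
    intro i j hij hjM
    apply layer_disjoint h ha0 ha1
    · intro x hx
      obtain ⟨-, y, hy, hxy⟩ := boundary_spec hx
      refine ⟨y, hy, hxy.le.trans ?_⟩
      have e : delta ^ (lev j) = delta ^ (s * j) * delta ^ k := by
        rw [hlev]; simp only; rw [zpow_add₀ hdp.ne', zpow_natCast, mul_comm]
      rw [e]
      have := zpow_pos hdp k
      gcongr ?_ * _
      exact pow_le_pow_of_le_one hdp.le h.delta_lt_one.le (Nat.mul_le_mul_left s hjM.le)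
    · have hD := zpow_pos hdp (lev i)
      have e : delta ^ (lev j) ≤ delta ^ s * delta ^ (lev i) := by
        rw [← zpow_natCast, ← zpow_add₀ hdp.ne']
        apply zpow_le_zpow_right_of_le_one₀ hdp h.delta_lt_one.le
        have : s * (i + 1) ≤ s * j := Nat.mul_le_mul_left s hij
        simp only [hlev]
        rw [mul_add, mul_one] at this
        have : ((s * i + s : ℕ) : ℤ) ≤ ((s * j : ℕ) : ℤ) := by exact_mod_cast this
        rw [Nat.cast_add] at this
        linarith
      calc _ ≤ 20 * A0 ^ 5 * (delta ^ s * delta ^ (lev i)) := by gcongr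
        _ = (20 * A0 ^ 5 * delta ^ s) * delta ^ (lev i) := by ring
        _ ≤ _ := by gcongr
  have hdisj : Set.PairwiseDisjoint (↑(Finset.range M)) G := by
    intro i hi j hj hij
    simp only [Finset.coe_range, mem_Iio] at hi hj
    rcases lt_or_gt_of_ne hij with h' | h'
    · exact hlt i j h' hj
    · exact (hlt j i h' hi).symm
  have hsum : ∑ j ∈ Finset.range M, mu (G j) ≤ mu (dyadicCube rho delta a0 z le k a) := by
    rw [← measure_biUnion_finset hdisj (fun j _ => (layer_open h heta).measurableSet)]
    exact measure_mono (iUnion₂_subset fun j _ => layer_subset hdp hea)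
  have hone : ∀ j, mu E ≤ ENNReal.ofReal A1 ^ p * mu (G j) := fun j =>
    layer_measure h hd ha0 ha k a E (fun x hx => hx.1) (lev j)
      (by simp only [hlev]; exact le_add_of_nonneg_right (Int.natCast_nonneg _)) _ heta hea hes p hp
  calc (M : ENNReal) * mu E = ∑ j ∈ Finset.range M, mu E := by simp
    _ ≤ ∑ j ∈ Finset.range M, ENNReal.ofReal A1 ^ p * mu (G j) := Finset.sum_le_sum fun j _ => hone j
    _ = ENNReal.ofReal A1 ^ p * ∑ j ∈ Finset.range M, mu (G j) := by rw [Finset.mul_sum]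
    _ ≤ _ := by gcongr

end helpers

/-- Lemma 20: for `δ, a0` sufficiently small (depending only on `A0, A1`), for each `ε > 0`
there is `τ > 0` (depending only on `A0, A1, δ, a0, ε`) with `μ(E^k_α(τ)) < ε μ(Q^k_α)`
for every dyadic cube. -/
theorem tauBoundary_measure_small (A0 A1 : ℝ) (hA0 : 1 ≤ A0) (hA1 : 1 ≤ A1) :
    ∃ delta0 > (0 : ℝ), ∃ a00 > (0 : ℝ),
      ∀ delta a0 : ℝ, 0 < delta → delta < delta0 → 0 < a0 → a0 < a00 →
      ∀ eps : ℝ, 0 < eps → ∃ tau > (0 : ℝ),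
        ∀ (X : Type) [TopologicalSpace X] [MeasurableSpace X] [BorelSpace X]
          (rho : X → X → ℝ) (mu : Measure X) (I : ℤ → Type) (z : ∀ k, I k → X)
          (le : ∀ k, I k → ∀ l, I l → Prop),
          DyadicSystem rho mu A0 A1 delta z le →
          ∀ (k : ℤ) (a : I k),
            mu (tauBoundary rho delta a0 z le k a tau) <
              ENNReal.ofReal eps * mu (dyadicCube rho delta a0 z le k a) := by
  have hA0p : 0 < A0 := by linarith
  refine ⟨min (1 / (12 * A0 ^ 3)) 1, by positivity, 1 / (4 * A0 ^ 3), by positivity, ?_⟩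
  intro delta a0 hdp hd0 ha0 ha eps heps
  have hd : 12 * A0 ^ 3 * delta < 1 := by
    have := hd0.trans_le (min_le_left _ _)
    rw [lt_div_iff₀ (by positivity)] at this
    linarith
  have hd1 : delta < 1 := hd0.trans_le (min_le_right _ _)
  have ha' : 4 * A0 ^ 3 * a0 < 1 := by
    rw [lt_div_iff₀ (by positivity)] at ha
    linarith
  obtain ⟨s, hs⟩ := exists_pow_lt_of_lt_one (show 0 < a0 / (20 * A0 ^ 5) by positivity) hd1
  have hs' : 20 * A0 ^ 5 * delta ^ s ≤ a0 := by
    rw [lt_div_iff₀ (by positivity)] at hs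
    linarith
  obtain ⟨p, hp⟩ := pow_unbounded_of_one_lt (4 * A0 ^ 2 / (a0 / (4 * A0))) (one_lt_two (α := ℝ))
  have hp' : 4 * A0 ^ 2 ≤ 2 ^ p * (a0 / (4 * A0)) := by
    rw [div_lt_iff₀ (by positivity)] at hp
    exact hp.le
  obtain ⟨M, hM⟩ := exists_nat_gt (A1 ^ p / eps)
  have hM' : A1 ^ p < M * eps := by rwa [div_lt_iff₀ heps] at hM
  refine ⟨delta ^ (s * M), by positivity, ?_⟩
  intro X _ _ _ rho mu I z le h k a
  have hb := boundary_bound h hd ha0 ha' s M p hs' hp' k a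
  have hpos := cube_pos h ha0 k a
  have htop := cube_lt_top h hd ha0 ha' k a
  by_contra hcon
  rw [not_lt] at hcon
  have h1 : (M : ENNReal) * (ENNReal.ofReal eps * mu (dyadicCube rho delta a0 z le k a)) ≤
      ENNReal.ofReal A1 ^ p * mu (dyadicCube rho delta a0 z le k a) := by
    refine le_trans ?_ hb
    gcongr
  rw [← mul_assoc, ENNReal.mul_le_mul_iff_left hpos.ne' htop.ne] at h1
  rw [← ENNReal.ofReal_pow (by linarith), ← ENNReal.ofReal_natCast,
    ← ENNReal.ofReal_mul (by positivity), ENNReal.ofReal_le_ofReal_iff (by positivity)] at h1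
  linarith
end

section
/- Under the standing assumptions, if additionally δ and a0 are smaller than 1/(8A0³), then the space (X,ρ) is bounded (i.e. diam(X) < ∞) if and only if there exists an index pair (k,α) such that X = Q^l_β for every (l,β) ⪰ (k,α). -/
open MeasureTheory Set

theorem center_dist {X : Type*} [TopologicalSpace X]
    [MeasurableSpace X] [BorelSpace X] {I : ℤ → Type*} (rho : X → X → ℝ) (mu : Measure X)
    (A0 A1 delta : ℝ) (z : ∀ k, I k → X) (le : ∀ k, I k → ∀ l, I l → Prop)
    (hsys : DyadicSystem rho mu A0 A1 delta z le)
    (hdelta : delta < 1 / (8 * A0 ^ 3)) (n : ℕ) :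
    ∀ (k : ℤ) (a : I k) (l : ℤ) (b : I l), l = k + n → le l b k a →
      rho (z l b) (z k a) ≤ 2 * A0 * delta ^ k := by
  have hA := hsys.homog.A0_ge_one
  have hd := hsys.delta_pos
  have hclose : ∀ (k m : ℤ) (a : I k) (b : I m), m = k - 1 → le k a m b →
      rho (z k a) (z m b) < delta ^ m := by
    intro k m a b h hle
    subst h
    exact hsys.le_close k a b hle
  induction n with
  | zero =>
    intro k a l b h hle
    have h' : l = k := by simpa using h
    subst h'
    obtain ⟨c, -, hc⟩ := hsys.exists_unique_ancestor l b l (_root_.le_refl l)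
    have e : a = b := (hc a hle).trans (hc b (hsys.le_refl l b)).symm
    subst e
    rw [(hsys.homog.eq_zero_iff _ _).2 rfl]
    positivity
  | succ n ih =>
    intro k a l b h hle
    push_cast at h
    obtain ⟨b', hb', -⟩ := hsys.exists_unique_ancestor l b (k + 1) (by omega)
    obtain ⟨c, hc, -⟩ := hsys.exists_unique_ancestor (k + 1) b' k (by omega)
    have e : c = a := (hsys.exists_unique_ancestor l b k (by omega)).unique
      (hsys.le_trans _ _ _ _ _ _ hb' hc) hle
    subst e
    have h1 := ih (k + 1) b' l b (by omega) hb'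
    have h2 := hclose (k + 1) k b' c (by omega) hc
    have h3 := hsys.homog.triangle (z l b) (z (k + 1) b') (z k c)
    have hp : 0 < delta ^ k := zpow_pos hd k
    rw [zpow_add_one₀ hd.ne'] at h1
    have h4 : delta * (8 * A0 ^ 3) < 1 := by
      rwa [lt_div_iff₀ (by positivity)] at hdelta
    have h5 : 2 * A0 * delta ≤ 1 := by
      have : A0 ≤ A0 ^ 3 := by nlinarith [sq_nonneg A0]
      nlinarith
    calc _ ≤ _ := h3
      _ ≤ A0 * (2 * A0 * (delta ^ k * delta)) + A0 * delta ^ k := by gcongr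
      _ = A0 * delta ^ k * (2 * A0 * delta + 1) := by ring
      _ ≤ A0 * delta ^ k * (1 + 1) := by gcongr
      _ = _ := by ring

/-- Corollary 21: `(X,ρ)` is bounded iff some index pair `(k,α)` satisfies `X = Q^l_β`
for every `(l,β) ⪰ (k,α)`. -/
theorem bounded_iff_cube_eq_univ {X : Type*} [TopologicalSpace X]
    [MeasurableSpace X] [BorelSpace X] {I : ℤ → Type*} (rho : X → X → ℝ) (mu : Measure X)
    (A0 A1 delta a0 : ℝ) (z : ∀ k, I k → X) (le : ∀ k, I k → ∀ l, I l → Prop)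
    (hsys : DyadicSystem rho mu A0 A1 delta z le)
    (ha0 : 0 < a0) (ha1 : a0 < 1)
    (hdelta : delta < 1 / (8 * A0 ^ 3)) (ha : a0 < 1 / (8 * A0 ^ 3)) :
    (∃ C : ℝ, ∀ x y : X, rho x y ≤ C) ↔
      (∃ (k : ℤ) (a : I k), ∀ (l : ℤ) (b : I l),
        le k a l b → dyadicCube rho delta a0 z le l b = Set.univ) := by
  have hA := hsys.homog.A0_ge_one
  have hd := hsys.delta_pos
  constructor
  · rintro ⟨C, hC⟩
    obtain ⟨x⟩ := hsys.homog.nonempty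
    obtain ⟨n, hn⟩ := pow_unbounded_of_one_lt (C / a0)
      ((one_lt_inv₀ hd).2 hsys.delta_lt_one)
    obtain ⟨a, -⟩ := hsys.maximal (-(n : ℤ)) x
    refine ⟨-(n : ℤ), a, fun l b hle => ?_⟩
    have hl := hsys.le_gen _ _ _ _ hle
    refine Set.eq_univ_of_forall fun y => ?_
    simp only [dyadicCube, Set.mem_iUnion]
    refine ⟨l, b, hsys.le_refl l b, ?_⟩
    have h1 : delta ^ (-(n : ℤ)) ≤ delta ^ l :=
      zpow_le_zpow_right_of_le_one₀ hd hsys.delta_lt_one.le hl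
    have h2 : delta⁻¹ ^ n = delta ^ (-(n : ℤ)) := by simp
    rw [h2, div_lt_iff₀ ha0] at hn
    have h3 := hC (z l b) y
    show rho (z l b) y < a0 * delta ^ l
    nlinarith
  · rintro ⟨k, a, h⟩
    have hu := h k a (hsys.le_refl k a)
    have hp : 0 < delta ^ k := zpow_pos hd k
    have key : ∀ y, rho y (z k a) ≤ A0 * delta ^ k + A0 * (2 * A0 * delta ^ k) := by
      intro y
      have hy : y ∈ dyadicCube rho delta a0 z le k a := hu ▸ Set.mem_univ y
      simp only [dyadicCube, Set.mem_iUnion] at hy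
      obtain ⟨l, b, hle, hy⟩ := hy
      have hy' : rho (z l b) y < a0 * delta ^ l := hy
      have hl := hsys.le_gen _ _ _ _ hle
      have h1 : delta ^ l ≤ delta ^ k :=
        zpow_le_zpow_right_of_le_one₀ hd hsys.delta_lt_one.le hl
      have hpl : 0 < delta ^ l := zpow_pos hd l
      have h2 := center_dist rho mu A0 A1 delta z le hsys hdelta (l - k).toNat k a l b
        (by omega) hle
      have h3 := hsys.homog.triangle y (z l b) (z k a)
      have h4 : rho y (z l b) ≤ delta ^ k := by
        rw [hsys.homog.symm]
        nlinarith
      refine h3.trans ?_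
      gcongr
    refine ⟨A0 * (A0 * delta ^ k + A0 * (2 * A0 * delta ^ k)) +
      A0 * (A0 * delta ^ k + A0 * (2 * A0 * delta ^ k)), fun x y => ?_⟩
    refine (hsys.homog.triangle x (z k a) y).trans ?_
    have hx := key x
    have hy := key y
    rw [hsys.homog.symm] at hy
    gcongr
end

section
/- Under the standing assumptions, if additionally δ and a0 are smaller than 1/(8A0³), then there exists a constant C depending only on A0, A1, δ and a0 such that whenever Q^k_α ⊂ Q^{k−1}_β are dyadic cubes, μ(Q^{k−1}_β) ≤ C μ(Q^k_α). -/
open MeasureTheory Set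

theorem aux_center_dist {X : Type*} [TopologicalSpace X] [MeasurableSpace X] [BorelSpace X]
    {rho : X → X → ℝ} {mu : Measure X} {A0 A1 delta : ℝ} {I : ℤ → Type*}
    {z : ∀ k, I k → X} {le : ∀ k, I k → ∀ l, I l → Prop}
    (h : DyadicSystem rho mu A0 A1 delta z le) (hdelta : delta < 1 / (8 * A0 ^ 3)) (n : ℕ) :
    ∀ (m : ℤ) (b : I m) (l : ℤ) (c : I l), l = m + n → le l c m b →
      rho (z l c) (z m b) ≤ 2 * A0 * delta ^ m := by
  have hA := h.homog.A0_ge_one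
  have hd := h.delta_pos
  induction n with
  | zero =>
    intro m b l c hl hle
    obtain rfl : l = m := by simpa using hl
    have : c = b := (h.exists_unique_ancestor l c l le_rfl).unique (h.le_refl l c) hle
    subst this
    rw [(h.homog.eq_zero_iff _ _).2 rfl]
    have := zpow_pos hd l
    positivity
  | succ n ih =>
    intro m b l c hl hle
    obtain ⟨p, rfl⟩ : ∃ p : ℤ, m = p - 1 := ⟨m + 1, by ring⟩
    have hl' : l = p + n := by push_cast at hl; linarith
    obtain ⟨d, hcd, -⟩ := h.exists_unique_ancestor l c p (by omega)
    obtain ⟨e, hde, -⟩ := h.exists_unique_ancestor p d (p - 1) (by omega)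
    have he : e = b := (h.exists_unique_ancestor l c (p - 1) (by omega)).unique
      (h.le_trans _ _ _ _ _ _ hcd hde) hle
    subst he
    have h1 := ih p d l c hl' hcd
    have h2 := h.le_close p d e hde
    have h3 := h.homog.triangle (z l c) (z p d) (z (p - 1) e)
    have hp : delta ^ p = delta * delta ^ (p - 1) := by
      rw [← zpow_one_add₀ hd.ne']; congr 1; ring
    rw [hp] at h1
    have ht := zpow_pos hd (p - 1)
    generalize delta ^ (p - 1) = t at *
    have hA0 : 0 < A0 := by linarith
    have hk : delta * (8 * A0 ^ 3) < 1 := (lt_div_iff₀ (by positivity)).1 hdelta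
    have hk2 : 2 * A0 ^ 2 * delta ≤ 1 := by
      have : A0 ^ 2 ≤ A0 ^ 3 := pow_le_pow_right₀ hA (by norm_num)
      nlinarith [pow_pos hA0 2, pow_pos hA0 3]
    have e1 : A0 * rho (z l c) (z p d) ≤ A0 * (2 * A0 * (delta * t)) := by gcongr
    have e2 : A0 * rho (z p d) (z (p - 1) e) ≤ A0 * t := by gcongr
    have e3 : 2 * A0 ^ 2 * delta * t ≤ 1 * t := by gcongr
    have e4 : 1 * t ≤ A0 * t := by gcongr
    nlinarith

theorem aux_doubling {X : Type*} [TopologicalSpace X] [MeasurableSpace X] [BorelSpace X]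
    {rho : X → X → ℝ} {mu : Measure X} {A0 A1 : ℝ}
    (h : IsHomogeneous rho mu A0 A1) (x : X) (r : ℝ) (hr : 0 < r) (n : ℕ) :
    mu {y | rho x y < 2 ^ n * r} ≤ ENNReal.ofReal (A1 ^ n) * mu {y | rho x y < r} := by
  have hA := h.A1_ge_one
  induction n with
  | zero => simp
  | succ n ih =>
    have := h.doubling x (2 ^ n * r) (by positivity)
    rw [pow_succ', pow_succ', mul_assoc, ENNReal.ofReal_mul (by linarith), mul_assoc]
    exact this.trans (by gcongr)

/-- Corollary 22: there is `C` (depending only on `A0, A1, δ, a0`) such that a dyadic cube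
has measure at most `C` times the measure of any of its children. -/
theorem measure_parent_le (A0 A1 delta a0 : ℝ) (hA0 : 1 ≤ A0) (hA1 : 1 ≤ A1)
    (hd0 : 0 < delta) (hd1 : delta < 1) (ha0 : 0 < a0) (ha1 : a0 < 1)
    (hdelta : delta < 1 / (8 * A0 ^ 3)) (ha : a0 < 1 / (8 * A0 ^ 3)) :
    ∃ C : ℝ, ∀ (X : Type) [TopologicalSpace X] [MeasurableSpace X] [BorelSpace X]
      (rho : X → X → ℝ) (mu : Measure X) (I : ℤ → Type) (z : ∀ k, I k → X)
      (le : ∀ k, I k → ∀ l, I l → Prop),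
      DyadicSystem rho mu A0 A1 delta z le →
      ∀ (k : ℤ) (a : I k) (b : I (k - 1)),
        dyadicCube rho delta a0 z le k a ⊆ dyadicCube rho delta a0 z le (k - 1) b →
        mu (dyadicCube rho delta a0 z le (k - 1) b) ≤
          ENNReal.ofReal C * mu (dyadicCube rho delta a0 z le k a) := by
  obtain ⟨N, hN⟩ := pow_unbounded_of_one_lt (6 * A0 ^ 3 / (delta * a0)) (one_lt_two)
  refine ⟨A1 ^ N, ?_⟩
  intro X _ _ _ rho mu I z le h k a b hsub
  have hA0' : 0 < A0 := by linarith
  have ht := zpow_pos hd0 (k - 1)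
  have hr : 0 < a0 * delta ^ k := mul_pos ha0 (zpow_pos hd0 k)
  have hball : {y | rho (z k a) y < a0 * delta ^ k} ⊆ dyadicCube rho delta a0 z le k a := by
    intro y hy
    simp only [dyadicCube, mem_iUnion]
    exact ⟨k, a, h.le_refl k a, hy⟩
  have hfar : ∀ y ∈ dyadicCube rho delta a0 z le (k - 1) b,
      rho (z (k - 1) b) y < 3 * A0 ^ 2 * delta ^ (k - 1) := by
    intro y hy
    simp only [dyadicCube, mem_iUnion] at hy
    obtain ⟨l, c, hle, hy⟩ := hy
    have hl := h.le_gen _ _ _ _ hle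
    have h1 := aux_center_dist h hdelta (l - (k - 1)).toNat (k - 1) b l c (by omega) hle
    have h2 : rho (z l c) y < a0 * delta ^ l := hy
    have h3 : delta ^ l ≤ delta ^ (k - 1) := zpow_le_zpow_right_of_le_one₀ hd0 hd1.le hl
    have h4 : rho (z l c) y < delta ^ (k - 1) :=
      h2.trans_le (by nlinarith [zpow_pos hd0 l])
    have h5 := h.homog.triangle (z (k - 1) b) (z l c) y
    rw [h.homog.symm (z (k - 1) b) (z l c)] at h5
    generalize delta ^ (k - 1) = t at *
    have e1 : A0 * rho (z l c) (z (k - 1) b) ≤ A0 * (2 * A0 * t) := by gcongr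
    have e2 : A0 * rho (z l c) y < A0 * t := by gcongr
    have e3 : A0 * (1 * t) ≤ A0 * (A0 * t) := by gcongr
    nlinarith
  have hza : z k a ∈ dyadicCube rho delta a0 z le (k - 1) b := by
    apply hsub
    apply hball
    simpa [(h.homog.eq_zero_iff _ _).2 rfl] using hr
  have hcov : dyadicCube rho delta a0 z le (k - 1) b ⊆
      {y | rho (z k a) y < 2 ^ N * (a0 * delta ^ k)} := by
    intro y hy
    have h1 := hfar y hy
    have h2 := hfar _ hza
    have h3 := h.homog.triangle (z k a) (z (k - 1) b) y
    rw [h.homog.symm (z k a) (z (k - 1) b)] at h3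
    have hp : delta ^ k = delta * delta ^ (k - 1) := by
      rw [← zpow_one_add₀ hd0.ne']; congr 1; ring
    show rho (z k a) y < 2 ^ N * (a0 * delta ^ k)
    rw [hp]
    have hN' : 6 * A0 ^ 3 < 2 ^ N * (delta * a0) := (div_lt_iff₀ (by positivity)).1 hN
    have e0 := mul_lt_mul_of_pos_right hN' ht
    generalize delta ^ (k - 1) = t at *
    have e1 := mul_lt_mul_of_pos_left h1 hA0'
    have e2 := mul_lt_mul_of_pos_left h2 hA0'
    calc rho (z k a) y ≤ _ := h3
      _ < 6 * A0 ^ 3 * t := by linarith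
      _ < 2 ^ N * (delta * a0) * t := e0
      _ = _ := by ring
  calc mu (dyadicCube rho delta a0 z le (k - 1) b) ≤ _ := measure_mono hcov
    _ ≤ _ := aux_doubling h.homog (z k a) _ hr N
    _ ≤ _ := by gcongr
end
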